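/- For every μ, ν ∈ M₊(X) with μ(X) = ν(X), F(μ,ν) = sup { ∫_X ψ dν − ∫_X ψ dμ : ψ ∈ C²_c(ℝ^d) with −ψ = (−ψ)^G on Ω }. -/

import Mathlib

open MeasureTheory Set Filter Topology
open scoped ENNReal NNReal Classical

noncomputable section

/-- Euclidean space `ℝ^d`. -/
abbrev Ed (d : ℕ) := EuclideanSpace ℝ (Fin d)

/-- The space `M_d` of real `d × d` matrices. -/
abbrev Matd (d : ℕ) := Matrix (Fin d) (Fin d) ℝ

/-- The Frobenius inner product `A : B = tr(Aᵀ B)`. -/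
def frob {d : ℕ} (A B : Matd d) : ℝ := ∑ i, ∑ j, A i j * B i j

/-- The Frobenius norm of a matrix. -/
def matnorm {d : ℕ} (A : Matd d) : ℝ := Real.sqrt (frob A A)

/-- The Hessian matrix `∇²φ(x)`. -/
def hess {d : ℕ} (φ : Ed d → ℝ) (x : Ed d) : Matd d :=
  fun i j => iteratedFDeriv ℝ 2 φ x ![EuclideanSpace.single i 1, EuclideanSpace.single j 1]

/-- `φ ∈ C²_c(ℝ^d)`. -/
def IsC2c {d : ℕ} (φ : Ed d → ℝ) : Prop := ContDiff ℝ 2 φ ∧ HasCompactSupport φ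

/-- Assumption (A1): `dom f ⊆ S⁺_d`, `f` is coercive and sublinear
(subadditive and positively 1-homogeneous). -/
def CostA1 {d : ℕ} (f : Matd d → ℝ≥0∞) : Prop :=
  (∀ M, f M ≠ ⊤ → M.PosSemidef) ∧
  (∃ c : ℝ, 0 < c ∧ ∀ M, ENNReal.ofReal (c * matnorm M) ≤ f M) ∧
  (∀ A B, f (A + B) ≤ f A + f B) ∧
  (∀ t : ℝ, 0 ≤ t → ∀ A, f (t • A) = ENNReal.ofReal t * f A)

/-- Assumption (A2): `f` is lower semicontinuous. -/
def CostA2 {d : ℕ} (f : Matd d → ℝ≥0∞) : Prop := LowerSemicontinuous f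

/-- `dom(f⋆) = {A | A : M ≤ f(M) for all M ∈ dom f}`. -/
def domFstar {d : ℕ} (f : Matd d → ℝ≥0∞) : Set (Matd d) :=
  { A | ∀ M, f M ≠ ⊤ → ENNReal.ofReal (frob A M) ≤ f M }

/-- A competitor `λ = ρ·m` (an `S⁺_d`-valued measure supported in `X`) for the static problem:
`tr(½∇²λ) = ν − μ` in the distributional sense. -/
def IsStaticCompetitor {d : ℕ} (X : Set (Ed d)) (μ ν : Measure (Ed d))
    (m : Measure (Ed d)) (ρ : Ed d → Matd d) : Prop :=
  IsFiniteMeasure m ∧ m Xᶜ = 0 ∧ (∀ x, (ρ x).PosSemidef) ∧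
    ∀ φ : Ed d → ℝ, IsC2c φ →
      ∫ x, (1/2 : ℝ) * frob (hess φ x) (ρ x) ∂m = ∫ x, φ x ∂ν - ∫ x, φ x ∂μ

/-- The static value `F(μ,ν)` (using the positive 1-homogeneity of `f`, the cost of
`λ = ρ·m` is `∫ f(dλ/d|λ|) d|λ| = ∫ f(ρ) dm`). -/
def Fstat {d : ℕ} (f : Matd d → ℝ≥0∞) (X : Set (Ed d)) (μ ν : Measure (Ed d)) : ℝ≥0∞ :=
  sInf { c | ∃ m ρ, IsStaticCompetitor X μ ν m ρ ∧ c = ∫⁻ x, f (ρ x) ∂m }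

/-- `(ϱ, λ)`, with `ϱ = ϱ_t ⊗ L¹⌞(0,1)` and `λ = (ρ_t · m_t) ⊗ L¹⌞(0,1)` an `S⁺_d`-valued
measure, solves the Fokker–Planck equation `∂_t ϱ = tr(½∇²λ)` on `(0,1) × ℝ^d`. -/
def SolvesFPE {d : ℕ} (ϱ : ℝ → Measure (Ed d)) (m : ℝ → Measure (Ed d))
    (ρ : ℝ → Ed d → Matd d) : Prop :=
  (∀ t ∈ Ioo (0:ℝ) 1, IsFiniteMeasure (ϱ t) ∧ IsFiniteMeasure (m t)) ∧
  (∀ t ∈ Ioo (0:ℝ) 1, ∀ x, (ρ t x).PosSemidef) ∧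
  (∀ A : Set (Ed d), IsCompact A →
    (∫⁻ t in Ioo (0:ℝ) 1, ∫⁻ x in A, ENNReal.ofReal (matnorm (ρ t x)) ∂(m t)) < ⊤) ∧
  (∀ φ : ℝ × Ed d → ℝ, ContDiff ℝ 2 φ → HasCompactSupport φ →
    tsupport φ ⊆ Ioo (0:ℝ) 1 ×ˢ (univ : Set (Ed d)) →
    (∫ t in Ioo (0:ℝ) 1, ∫ x, fderiv ℝ φ (t, x) (1, 0) ∂(ϱ t)) =
      - ∫ t in Ioo (0:ℝ) 1, ∫ x, (1/2 : ℝ) * frob (hess (fun y => φ (t, y)) x) (ρ t x) ∂(m t))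

/-- The support condition (⋆): `supp ϱ_t, supp λ_t ⊆ X` for a.e. `t ∈ (0,1)`. -/
def SuppCond {d : ℕ} (X : Set (Ed d)) (ϱ m : ℝ → Measure (Ed d)) : Prop :=
  ∀ᵐ t ∂(volume.restrict (Ioo (0:ℝ) 1)), (ϱ t) Xᶜ = 0 ∧ (m t) Xᶜ = 0

/-- `μ` is the weak* (narrow) limit of `ϱ_t` as `t → t₀` within `(0,1)`. -/
def NarrowLim {d : ℕ} (ϱ : ℝ → Measure (Ed d)) (t₀ : ℝ) (μ : Measure (Ed d)) : Prop :=
  ∀ g : BoundedContinuousFunction (Ed d) ℝ,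
    Tendsto (fun t => ∫ x, g x ∂(ϱ t)) (𝓝[Ioo (0:ℝ) 1] t₀) (𝓝 (∫ x, g x ∂μ))

/-- The dynamic (Benamou–Brenier type) value `F(μ,ν)`. -/
def Fdyn {d : ℕ} (f : Matd d → ℝ≥0∞) (X : Set (Ed d)) (μ ν : Measure (Ed d)) : ℝ≥0∞ :=
  sInf { c | ∃ ϱ m ρ, SolvesFPE ϱ m ρ ∧ SuppCond X ϱ m ∧
      NarrowLim ϱ 0 μ ∧ NarrowLim ϱ 1 ν ∧
      c = ∫⁻ t in Ioo (0:ℝ) 1, ∫⁻ x, f (ρ t x) ∂(m t) }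

/-- the cost `G(x,p) := F(δ_x, p)`. -/
def Gcost {d : ℕ} (f : Matd d → ℝ≥0∞) (X : Set (Ed d)) (x : Ed d)
    (p : Measure (Ed d)) : ℝ≥0∞ :=
  Fstat f X (Measure.dirac x) p

/-- A disintegration kernel `x ↦ γ^x` of a transport plan `γ ∈ Π(μ,ν)`. -/
def IsTransportKernel {d : ℕ} (X : Set (Ed d)) (μ ν : Measure (Ed d))
    (κ : Ed d → Measure (Ed d)) : Prop :=
  (∀ x, IsProbabilityMeasure (κ x) ∧ (κ x) Xᶜ = 0) ∧
  (∀ A : Set (Ed d), MeasurableSet A → Measurable fun x => κ x A) ∧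
  (∀ A : Set (Ed d), MeasurableSet A → ∫⁻ x, κ x A ∂μ = ν A)

/-- The static optimal transport value `H(μ,ν) = inf_{γ ∈ Π(μ,ν)} ∫ G(x,γ^x) dμ`. -/
def Hcost {d : ℕ} (f : Matd d → ℝ≥0∞) (X : Set (Ed d)) (μ ν : Measure (Ed d)) : ℝ≥0∞ :=
  sInf { c | ∃ κ, IsTransportKernel X μ ν κ ∧ c = ∫⁻ x, Gcost f X x (κ x) ∂μ }

/-- Integral of `φ` against a signed measure. -/
def sInt {d : ℕ} (s : SignedMeasure (Ed d)) (φ : Ed d → ℝ) : ℝ :=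
  ∫ x, φ x ∂s.toJordanDecomposition.posPart - ∫ x, φ x ∂s.toJordanDecomposition.negPart

/-- A signed measure is supported in `X`. -/
def SuppInX {d : ℕ} (X : Set (Ed d)) (s : SignedMeasure (Ed d)) : Prop :=
  ∀ A : Set (Ed d), MeasurableSet A → A ⊆ Xᶜ → s A = 0

/-- The extension of `F` to signed measures: `+∞` unless `μ, ν ≥ 0` with equal masses. -/
def FSgn {d : ℕ} (f : Matd d → ℝ≥0∞) (X : Set (Ed d)) (μ ν : SignedMeasure (Ed d)) : ℝ≥0∞ :=
  if 0 ≤ μ ∧ 0 ≤ ν ∧ μ univ = ν univ then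
    Fstat f X μ.toJordanDecomposition.posPart ν.toJordanDecomposition.posPart
  else ⊤

/-- The extension of `H` to signed measures: `+∞` unless `μ, ν ≥ 0` with equal masses. -/
def HSgn {d : ℕ} (f : Matd d → ℝ≥0∞) (X : Set (Ed d)) (μ ν : SignedMeasure (Ed d)) : ℝ≥0∞ :=
  if 0 ≤ μ ∧ 0 ≤ ν ∧ μ univ = ν univ then
    Hcost f X μ.toJordanDecomposition.posPart ν.toJordanDecomposition.posPart
  else ⊤

/-- The weak* topology on signed measures, in duality with continuous functions. -/
def weakStarTop (d : ℕ) : TopologicalSpace (SignedMeasure (Ed d)) :=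
  ⨅ g : C(Ed d, ℝ), TopologicalSpace.induced (fun s => sInt s g) inferInstance

/-- The `G`-transform `φ^G(x) = inf { ∫ φ dp + G(x,p) : p ∈ P(X) }`. -/
def GTrans {d : ℕ} (f : Matd d → ℝ≥0∞) (X : Set (Ed d)) (φ : Ed d → ℝ) (x : Ed d) : EReal :=
  sInf { c : EReal | ∃ p : Measure (Ed d), IsProbabilityMeasure p ∧ p Xᶜ = 0 ∧
      c = ((∫ y, φ y ∂p : ℝ) : EReal) + (Gcost f X x p : EReal) }

/-- `φ = φ^G` on `E`. -/
def GEq {d : ℕ} (f : Matd d → ℝ≥0∞) (X : Set (Ed d)) (φ : Ed d → ℝ) (E : Set (Ed d)) : Prop :=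
  ∀ x ∈ E, GTrans f X φ x = ((φ x : ℝ) : EReal)

/-- `𝒯(A) = sup { A : M | M ∈ S⁺⁺_d, f(M) = 1 }`. -/
def Tcal {d : ℕ} (f : Matd d → ℝ≥0∞) (A : Matd d) : EReal :=
  sSup { c : EReal | ∃ M : Matd d, M.PosDef ∧ f M = 1 ∧ c = ((frob A M : ℝ) : EReal) }

/-- `u` is a viscosity supersolution of `c − 𝒯(½∇²u) = 0` in `U`. -/
def IsViscSupersol {d : ℕ} (f : Matd d → ℝ≥0∞) (c : ℝ) (u : Ed d → ℝ) (U : Set (Ed d)) : Prop :=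
  ∀ φ : Ed d → ℝ, ContDiffOn ℝ 2 φ U → ∀ x ∈ U,
    IsLocalMinOn (fun y => u y - φ y) U x →
    Tcal f ((1/2 : ℝ) • hess φ x) ≤ ((c : ℝ) : EReal)

/-- Integral of an `EReal`-valued function against a measure
(positive part minus negative part). -/
def erealInt {d : ℕ} (m : Measure (Ed d)) (u : Ed d → EReal) : EReal :=
  ((∫⁻ y, ENNReal.ofReal ((u y).toReal) ∂m : ℝ≥0∞) : EReal) -
    ((∫⁻ y, (if u y = ⊥ then (⊤ : ℝ≥0∞) else ENNReal.ofReal (-(u y).toReal)) ∂m : ℝ≥0∞) : EReal)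

/-- `u : U → ℝ ∪ {−∞}` is subharmonic on the open set `U`: it is upper semicontinuous,
not identically `−∞` on any connected component, and satisfies the sub-mean value
inequality on spheres. -/
def Subharmonic {d : ℕ} (U : Set (Ed d)) (u : Ed d → EReal) : Prop :=
  (∀ x, u x ≠ ⊤) ∧
  (∀ x ∈ U, ∃ y ∈ connectedComponentIn U x, u y ≠ ⊥) ∧
  UpperSemicontinuousOn u U ∧
  (∀ x ∈ U, ∀ r : ℝ, 0 < r → Metric.closedBall x r ⊆ U →
    (((μH[(d : ℝ) - 1] (Metric.sphere x r)).toReal : ℝ) : EReal) * u x ≤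
      erealInt ((μH[(d : ℝ) - 1]).restrict (Metric.sphere x r)) u)

/-- The (topological) support of a measure. -/
def msupp {d : ℕ} (m : Measure (Ed d)) : Set (Ed d) :=
  { x | ∀ U : Set (Ed d), IsOpen U → x ∈ U → m U ≠ 0 }

/-- `m₁ ≤_SH m₂`: subharmonic order. -/
def SHOrder {d : ℕ} (m₁ m₂ : Measure (Ed d)) : Prop :=
  ∀ U : Set (Ed d), IsOpen U → msupp (m₁ + m₂) ⊆ U →
    ∀ u : Ed d → EReal, Subharmonic U u →
      erealInt (m₁.restrict U) u ≤ erealInt (m₂.restrict U) u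

/-- The second moment matrix `∫ x ⊗ x dκ`. -/
def secondMoment {d : ℕ} (κ : Measure (Ed d)) : Matd d :=
  fun i j => ∫ x, x i * x j ∂κ

end

theorem frob_add_left {d : ℕ} (A B C : Matd d) : frob (A + B) C = frob A C + frob B C := by
  simp [frob, add_mul, Finset.sum_add_distrib]
theorem frob_smul_left {d : ℕ} (t : ℝ) (A C : Matd d) : frob (t • A) C = t * frob A C := by
  simp [frob, Finset.mul_sum, mul_assoc]
theorem frob_add_right {d : ℕ} (A B C : Matd d) : frob A (B + C) = frob A B + frob A C := by
  simp [frob, mul_add, Finset.sum_add_distrib]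
theorem frob_smul_right {d : ℕ} (t : ℝ) (A C : Matd d) : frob A (t • C) = t * frob A C := by
  simp only [frob, Finset.mul_sum, Matrix.smul_apply, smul_eq_mul]
  congr! 2; ring
theorem frob_continuous {d : ℕ} : Continuous (fun p : Matd d × Matd d => frob p.1 p.2) := by
  unfold frob; fun_prop
theorem frob_continuous_left {d : ℕ} (M : Matd d) : Continuous (fun A : Matd d => frob A M) := by
  unfold frob; fun_prop
theorem hess_eq {d : ℕ} (φ : Ed d → ℝ) (x : Ed d) (i j : Fin d) :
    hess φ x i j = fderiv ℝ (fderiv ℝ φ) x (EuclideanSpace.single i 1) (EuclideanSpace.single j 1) := by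
  simp [hess, iteratedFDeriv_two_apply]
theorem hess_continuous {d : ℕ} {φ : Ed d → ℝ} (h : ContDiff ℝ 2 φ) : Continuous (hess φ) := by
  have h1 : ContDiff ℝ 1 (fderiv ℝ φ) := h.fderiv_right (by norm_num)
  have h2 : Continuous (fderiv ℝ (fderiv ℝ φ)) := h1.continuous_fderiv (by norm_num)
  refine continuous_pi fun i => continuous_pi fun j => ?_
  simp only [hess_eq]
  fun_prop

theorem zero_competitor {d : ℕ} (X : Set (Ed d)) (μ : Measure (Ed d)) :
    IsStaticCompetitor X μ μ 0 (fun _ => 0) := by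
  refine ⟨inferInstance, by simp, fun _ => Matrix.PosSemidef.zero, fun φ _ => by simp⟩

theorem Fstat_self {d : ℕ} (f : Matd d → ℝ≥0∞) (X : Set (Ed d)) (μ : Measure (Ed d)) :
    Fstat f X μ μ = 0 := by
  refine le_antisymm (sInf_le ⟨0, fun _ => 0, zero_competitor X μ, by simp⟩) zero_le

theorem ofReal_integral_le_lint {α : Type*} [MeasurableSpace α] (m : Measure α) (g : α → ℝ) :
    ENNReal.ofReal (∫ x, g x ∂m) ≤ ∫⁻ x, ENNReal.ofReal (g x) ∂m := by
  by_cases hg : Integrable g m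
  · rw [integral_eq_lintegral_pos_part_sub_lintegral_neg_part hg]
    refine (ENNReal.ofReal_le_ofReal (sub_le_self _ ENNReal.toReal_nonneg)).trans ?_
    exact ENNReal.ofReal_toReal_le
  · simp [integral_undef hg]

theorem weak_dual {d : ℕ} (f : Matd d → ℝ≥0∞) (X : Set (Ed d)) (μ ν : Measure (Ed d))
    (ψ : Ed d → ℝ) (hψ : IsC2c ψ)
    (hD : ∀ x ∈ X, (1/2 : ℝ) • hess ψ x ∈ domFstar f) :
    ENNReal.ofReal (∫ x, ψ x ∂ν - ∫ x, ψ x ∂μ) ≤ Fstat f X μ ν := by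
  refine le_sInf ?_
  rintro c ⟨m, ρ, ⟨hm, hmX, hρ, hφ⟩, rfl⟩
  rw [← hφ ψ hψ]
  refine (ofReal_integral_le_lint _ _).trans (lintegral_mono_ae ?_)
  have : ∀ᵐ x ∂m, x ∈ X := by
    rw [ae_iff]; exact hmX
  filter_upwards [this] with x hx
  by_cases h : f (ρ x) = ⊤
  · rw [h]; exact le_top
  · have := hD x hx _ h
    rwa [frob_smul_left] at this

theorem GEq_of_D {d : ℕ} (f : Matd d → ℝ≥0∞) (Ω X : Set (Ed d)) (hX : Ω ⊆ X)
    (ψ : Ed d → ℝ) (hψ : IsC2c ψ)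
    (hD : ∀ x ∈ X, (1/2 : ℝ) • hess ψ x ∈ domFstar f) : GEq f X (fun y => -ψ y) Ω := by
  intro x hx
  refine le_antisymm (sInf_le ⟨Measure.dirac x, inferInstance, ?_, ?_⟩) (le_sInf ?_)
  · rw [Measure.dirac_apply]; simp [hX hx]
  · simp [Gcost, Fstat_self]
  · rintro c ⟨p, hp, hpX, rfl⟩
    have h := weak_dual f X (Measure.dirac x) p ψ hψ hD
    rw [integral_neg]
    simp only [integral_dirac] at h
    unfold Gcost
    by_cases hT : Fstat f X (Measure.dirac x) p = ⊤
    · rw [hT]; simp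
    · lift Fstat f X (Measure.dirac x) p to ℝ≥0 using hT with t
      have h' : ∫ y, ψ y ∂p - ψ x ≤ (t : ℝ) := by
        have := ENNReal.ofReal_le_iff_le_toReal (by simp) |>.1 h
        simpa using this
      have : ((-ψ x : ℝ) : EReal) ≤ ((-∫ y, ψ y ∂p + (t : ℝ) : ℝ) : EReal) := by
        exact_mod_cast (by linarith)
      exact this

theorem hasDerivAt_maxsq (s : ℝ) : HasDerivAt (fun s : ℝ => (max s 0)^2) (2 * max s 0) s := by
  rcases lt_trichotomy s 0 with h | h | h
  · have : (fun s : ℝ => (max s 0)^2) =ᶠ[𝓝 s] fun _ => 0 := by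
      filter_upwards [gt_mem_nhds h] with t ht
      simp [max_eq_right (le_of_lt ht)]
    rw [max_eq_right h.le]
    simpa using (hasDerivAt_const s (0:ℝ)).congr_of_eventuallyEq this
  · subst h
    rw [hasDerivAt_iff_isLittleO]
    simp only [max_self, sub_zero, smul_eq_mul, mul_zero]
    refine Asymptotics.IsBigO.trans_isLittleO (g := fun x : ℝ => x^2) ?_ ?_
    · refine Asymptotics.IsBigO.of_bound 1 (Eventually.of_forall fun x => ?_)
      rcases le_total x 0 with hx | hx
      · simp [max_eq_right hx]; positivity
      · simp [max_eq_left hx]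
    · simpa using Asymptotics.isLittleO_pow_pow (𝕜 := ℝ) (m := 1) (n := 2) (by norm_num)
  · have : (fun s : ℝ => (max s 0)^2) =ᶠ[𝓝 s] fun s => s^2 := by
      filter_upwards [lt_mem_nhds h] with t ht
      simp [max_eq_left (le_of_lt ht)]
    rw [max_eq_left h.le]
    simpa using (hasDerivAt_pow 2 s).congr_of_eventuallyEq this

theorem noise_fun (n : ℕ) : ∃ (g h : Ed n → ℝ), Continuous g ∧ Continuous h ∧
    (∀ z, 0 ≤ g z) ∧ (∀ z, 0 ≤ h z) ∧ HasCompactSupport g ∧ HasCompactSupport h ∧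
    ∫ z, g z = 1 ∧ h 0 ≠ 0 ∧ (∀ z, z ∉ Metric.closedBall (0 : Ed n) 1 → g z = 0 ∧ h z = 0) ∧
    Differentiable ℝ h ∧
    ∀ z (k : Fin n), fderiv ℝ h z (EuclideanSpace.single k 1) = - (g z * z k) := by
  obtain ⟨q, hq⟩ : ∃ q : Ed n → ℝ, ∀ z, q z = max (1 - ‖z‖^2) 0 := ⟨_, fun _ => rfl⟩
  have hqc : Continuous q := by
    rw [show q = fun z => max (1 - ‖z‖^2) 0 from funext hq]; fun_prop
  have hq0 : ∀ z, 0 ≤ q z := fun z => by rw [hq]; exact le_max_right _ _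
  have hqs : ∀ z, z ∉ Metric.closedBall (0 : Ed n) 1 → q z = 0 := by
    intro z hz
    have : 1 < ‖z‖ := by simpa using hz
    rw [hq]
    exact max_eq_right (by nlinarith)
  have hqcs : HasCompactSupport q :=
    HasCompactSupport.intro (isCompact_closedBall (0 : Ed n) 1) (fun z hz => hqs z hz)
  obtain ⟨C, hCd⟩ : ∃ C : ℝ, C = ∫ z, 4 * q z := ⟨_, rfl⟩
  have hC : 0 < C := by
    rw [hCd]
    have h4 : Continuous fun z => 4 * q z := by fun_prop
    refine h4.integral_pos_of_hasCompactSupport_nonneg_nonzero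
      (x := 0) hqcs.mul_left (fun z => by have := hq0 z; positivity) ?_
    simp [hq]
  obtain ⟨g, hg⟩ : ∃ g : Ed n → ℝ, ∀ z, g z = 4 * q z / C := ⟨_, fun _ => rfl⟩
  obtain ⟨h, hh⟩ : ∃ h : Ed n → ℝ, ∀ z, h z = (q z)^2 / C := ⟨_, fun _ => rfl⟩
  have hgc : Continuous g := by rw [show g = _ from funext hg]; fun_prop
  have hhc : Continuous h := by rw [show h = _ from funext hh]; fun_prop
  have hg0 : ∀ z, 0 ≤ g z := fun z => by have := hq0 z; rw [hg]; positivity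
  have hh0 : ∀ z, 0 ≤ h z := fun z => by have := hq0 z; rw [hh]; positivity
  have hgs : HasCompactSupport g :=
    HasCompactSupport.intro (isCompact_closedBall (0 : Ed n) 1) (fun z hz => by simp [hg, hqs z hz])
  have hhs : HasCompactSupport h :=
    HasCompactSupport.intro (isCompact_closedBall (0 : Ed n) 1) (fun z hz => by simp [hh, hqs z hz])
  have hder : ∀ z, HasFDerivAt h (-(g z) • (innerSL ℝ z)) z := by
    intro z
    have h1 : HasFDerivAt (fun z : Ed n => 1 - ‖z‖^2) (-(2 • (innerSL ℝ z))) z := by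
      exact (hasStrictFDerivAt_norm_sq z).hasFDerivAt.const_sub 1
    have h2 := ((hasDerivAt_maxsq (1 - ‖z‖^2)).comp_hasFDerivAt z h1).mul_const (C⁻¹)
    have e : h = fun z => (fun s : ℝ => (max s 0)^2) (1 - ‖z‖^2) * C⁻¹ := by
      funext w; rw [hh, hq]; rfl
    rw [e]
    refine h2.congr_fderiv ?_
    ext w
    simp [hg, hq]
    ring
  have hfd : ∀ z (k : Fin n), fderiv ℝ h z (EuclideanSpace.single k 1) = - (g z * z k) := by
    intro z k
    rw [(hder z).fderiv]
    simp [EuclideanSpace.inner_single_right]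
  refine ⟨g, h, hgc, hhc, hg0, hh0, hgs, hhs, ?_, ?_, ?_, fun z => (hder z).differentiableAt, hfd⟩
  · simp only [hg, integral_div]
    rw [← hCd]
    exact div_self hC.ne'
  · simp [hh, hq, hC.ne']
  · intro z hz
    simp [hg, hh, hqs z hz]

theorem noise (n : ℕ) : ∃ η ζ : Measure (Ed n), IsProbabilityMeasure η ∧ IsFiniteMeasure ζ ∧ ζ ≠ 0 ∧
    η (Metric.closedBall 0 1)ᶜ = 0 ∧ ζ (Metric.closedBall 0 1)ᶜ = 0 ∧
    ∀ (k : Fin n) (u : Ed n → ℝ), ContDiff ℝ 1 u →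
      ∫ z, u z * z k ∂η = ∫ z, fderiv ℝ u z (EuclideanSpace.single k 1) ∂ζ := by
  obtain ⟨g, h, hgc, hhc, hg0, hh0, hgs, hhs, hg1, hh1, hz0, hder, hfd⟩ := noise_fun n
  have hgi : Integrable g := hgc.integrable_of_hasCompactSupport hgs
  have hhi : Integrable h := hhc.integrable_of_hasCompactSupport hhs
  refine ⟨volume.withDensity fun z => ENNReal.ofReal (g z),
    volume.withDensity fun z => ENNReal.ofReal (h z), ⟨?_⟩, ?_, ?_, ?_, ?_, ?_⟩
  · rw [withDensity_apply _ MeasurableSet.univ, Measure.restrict_univ,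
      ← ofReal_integral_eq_lintegral_ofReal hgi (Eventually.of_forall hg0)]
    simp [hg1]
  · exact isFiniteMeasure_withDensity_ofReal hhi.2
  · intro h0
    have := congrArg (fun m => m univ) h0
    simp only [withDensity_apply _ MeasurableSet.univ, Measure.restrict_univ,
      ← ofReal_integral_eq_lintegral_ofReal hhi (Eventually.of_forall hh0)] at this
    have h3 : 0 < ∫ z, h z := hhc.integral_pos_of_hasCompactSupport_nonneg_nonzero
      (x := 0) hhs hh0 hh1
    simp at this
    linarith
  · rw [withDensity_apply _ Metric.isClosed_closedBall.measurableSet.compl]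
    rw [setLIntegral_congr_fun (g := fun _ => 0) Metric.isClosed_closedBall.measurableSet.compl
      (fun z hz => by simp [hz0 z hz])]
    simp
  · rw [withDensity_apply _ Metric.isClosed_closedBall.measurableSet.compl]
    rw [setLIntegral_congr_fun (g := fun _ => 0) Metric.isClosed_closedBall.measurableSet.compl
      (fun z hz => by simp [hz0 z hz])]
    simp
  · intro k u hu
    rw [integral_withDensity_eq_integral_toReal_smul (by fun_prop) (by simp),
      integral_withDensity_eq_integral_toReal_smul (by fun_prop) (by simp)]
    simp only [ENNReal.toReal_ofReal (hg0 _), ENNReal.toReal_ofReal (hh0 _), smul_eq_mul]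
    have huc := hu.continuous
    have hu' : Continuous fun z => fderiv ℝ u z (EuclideanSpace.single k 1) :=
      (hu.continuous_fderiv (by norm_num)).clm_apply continuous_const
    have key := integral_mul_fderiv_eq_neg_fderiv_mul_of_integrable (μ := (volume : Measure (Ed n)))
      (f := u) (g := h)
      (v := EuclideanSpace.single k 1)
      ((hu'.mul hhc).integrable_of_hasCompactSupport hhs.mul_left)
      (by
        simp only [hfd]
        refine Continuous.integrable_of_hasCompactSupport (by fun_prop) ?_
        exact (hgs.mul_right (f' := fun z : Ed n => z k)).neg.mul_left)
      ((huc.mul hhc).integrable_of_hasCompactSupport hhs.mul_left)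
      (fun z _ => (hu.differentiable (by norm_num)) z) (fun z _ => hder z)
    simp only [hfd] at key
    have e1 : ∫ z, u z * -(g z * z k) = - ∫ z, g z * (u z * z k) := by
      rw [← integral_neg]; congr 1; ext z; ring
    have e2 : ∫ z, fderiv ℝ u z (EuclideanSpace.single k 1) * h z
      = ∫ z, h z * fderiv ℝ u z (EuclideanSpace.single k 1) := by
      congr 1; ext z; ring
    rw [e1, e2] at key
    linarith

theorem integrable_of_cont_compact {α : Type*} [TopologicalSpace α] [MeasurableSpace α]
    [OpensMeasurableSpace α] [T2Space α] [SecondCountableTopology α]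
    (m : Measure α) [IsFiniteMeasure m] (K : Set α) (hK : IsCompact K) (hm : ∀ᵐ x ∂m, x ∈ K)
    (g : α → ℝ) (hg : Continuous g) : Integrable g m := by
  obtain ⟨C, hC⟩ := hK.exists_bound_of_continuousOn hg.continuousOn
  refine Integrable.of_bound hg.aestronglyMeasurable C ?_
  filter_upwards [hm] with x hx using hC x hx

theorem frob_hess_sum {d n : ℕ} (φ : Ed d → ℝ) (y : Ed d) (v : Fin n → (Fin d → ℝ)) :
    frob (hess φ y) (∑ i, Matrix.vecMulVec (v i) (star (v i))) =
      ∑ k, fderiv ℝ (fderiv ℝ φ) y (WithLp.toLp 2 (v k)) (WithLp.toLp 2 (v k)) := by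
  have hw : ∀ k, (WithLp.toLp 2 (v k) : Ed d) = ∑ i, (v k i) • EuclideanSpace.single i (1:ℝ) := by
    intro k
    ext j
    simp [Pi.single_apply]
  simp only [hw, map_sum, map_smul, _root_.sum_apply, _root_.smul_apply,
    smul_eq_mul, frob, hess_eq, Matrix.sum_apply, Matrix.vecMulVec_apply, Finset.mul_sum]
  rw [Finset.sum_comm' (t' := Finset.univ) (s' := fun _ => Finset.univ) (by simp)]
  conv_rhs => rw [Finset.sum_comm]
  refine Finset.sum_congr rfl fun j _ => ?_
  rw [Finset.sum_comm]
  refine Finset.sum_congr rfl fun k _ => ?_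
  refine Finset.sum_congr rfl fun i _ => ?_
  simp; ring

theorem ball_competitor {d : ℕ} (x : Ed d) (M : Matd d) (hM : M.PosSemidef) (δ : ℝ) (hδ : 0 < δ) :
    ∃ p m : Measure (Ed d), IsProbabilityMeasure p ∧ IsFiniteMeasure m ∧ m ≠ 0 ∧
      (∀ᵐ y ∂p, y ∈ Metric.ball x δ) ∧ (∀ᵐ y ∂m, y ∈ Metric.ball x δ) ∧
      ∀ φ : Ed d → ℝ, IsC2c φ →
        ∫ y, (1/2 : ℝ) * frob (hess φ y) M ∂m = ∫ y, φ y ∂p - φ x := by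
  obtain ⟨n, v, rfl⟩ := Matrix.posSemidef_iff_eq_sum_vecMulVec.1 hM
  obtain ⟨η, ζ, hη, hζ, hζ0, hηb, hζb, hIBP⟩ := noise n
  obtain ⟨w, hw⟩ : ∃ w : Fin n → Ed d, ∀ k, w k = WithLp.toLp 2 (v k) := ⟨_, fun _ => rfl⟩
  obtain ⟨b, hb⟩ : ∃ b : Ed n →L[ℝ] Ed d, ∀ z, b z = ∑ k, z k • w k := by
    refine ⟨∑ k, (EuclideanSpace.proj k : Ed n →L[ℝ] ℝ).smulRight (w k), fun z => ?_⟩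
    simp
  have hbs : ∀ k, b (EuclideanSpace.single k 1) = w k := by
    intro k
    rw [hb]
    simp [PiLp.single_apply, ite_smul]
  obtain ⟨R, hR0, hR⟩ : ∃ R : ℝ, 0 < R ∧ R * ‖b‖ < δ := by
    refine ⟨δ / (‖b‖ + 1), by positivity, ?_⟩
    rw [div_mul_eq_mul_div, div_lt_iff₀ (by positivity)]
    nlinarith [norm_nonneg b]
  have hin : ∀ r ∈ Ioc 0 R, ∀ z ∈ Metric.closedBall (0 : Ed n) 1, x + r • b z ∈ Metric.ball x δ := by
    intro r hr z hz
    have hz' : ‖z‖ ≤ 1 := by simpa using hz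
    rw [mem_ball_iff_norm, add_sub_cancel_left, norm_smul, Real.norm_of_nonneg hr.1.le]
    refine lt_of_le_of_lt ?_ hR
    have h1 : ‖b z‖ ≤ ‖b‖ := (b.le_opNorm z).trans (mul_le_of_le_one_right (norm_nonneg _) hz')
    exact mul_le_mul hr.2 h1 (norm_nonneg _) hR0.le
  have hηae : ∀ᵐ z ∂η, z ∈ Metric.closedBall (0 : Ed n) 1 := hηb
  have hζae : ∀ᵐ z ∂ζ, z ∈ Metric.closedBall (0 : Ed n) 1 := hζb
  let τ0 : Measure ℝ := volume.restrict (Ioc 0 R)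
  have hτ0 : ∀ᵐ r ∂τ0, r ∈ Ioc 0 R := ae_restrict_mem measurableSet_Ioc
  let τ : Measure ℝ := τ0.withDensity fun r => ENNReal.ofReal (2 * r)
  have hτ : ∀ᵐ r ∂τ, r ∈ Ioc 0 R := (withDensity_absolutelyContinuous _ _).ae_le hτ0
  have hτi : Integrable (fun r : ℝ => 2 * r) τ0 :=
    integrable_of_cont_compact τ0 (Icc 0 R) isCompact_Icc
      (by filter_upwards [hτ0] with r hr using Ioc_subset_Icc_self hr) _ (by fun_prop)
  have hτf : IsFiniteMeasure τ := isFiniteMeasure_withDensity_ofReal hτi.2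
  have hτ1 : τ ≠ 0 := by
    intro h0
    have h1 := congrArg (fun m => m univ) h0
    simp only [τ, withDensity_apply _ MeasurableSet.univ, Measure.restrict_univ,
      ← ofReal_integral_eq_lintegral_ofReal hτi
        (by filter_upwards [hτ0] with r hr; have := hr.1; simp; exact this.le)] at h1
    have h2 : ∫ r, 2 * r ∂τ0 = R^2 := by
      simp only [τ0]
      rw [← intervalIntegral.integral_of_le hR0.le, intervalIntegral.integral_const_mul, integral_id]
      ring
    rw [h2] at h1
    simp at h1
    nlinarith
  have hTc : Continuous fun q : ℝ × Ed n => x + q.1 • b q.2 := by fun_prop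
  have hSc : Continuous fun z : Ed n => x + R • b z := by fun_prop
  have hprod : ∀ (t : Measure ℝ) (s : Measure (Ed n)) [IsFiniteMeasure t] [IsFiniteMeasure s],
      (∀ᵐ r ∂t, r ∈ Ioc 0 R) → (∀ᵐ z ∂s, z ∈ Metric.closedBall (0 : Ed n) 1) →
      ∀ᵐ q ∂(t.prod s), q.1 ∈ Ioc 0 R ∧ q.2 ∈ Metric.closedBall (0 : Ed n) 1 := by
    intro t s _ _ ht hs
    filter_upwards [Measure.quasiMeasurePreserving_fst.ae ht,
      Measure.quasiMeasurePreserving_snd.ae hs] with q h1 h2 using ⟨h1, h2⟩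
  refine ⟨η.map fun z => x + R • b z, (τ.prod ζ).map fun q => x + q.1 • b q.2,
    Measure.isProbabilityMeasure_map hSc.aemeasurable, inferInstance, ?_, ?_, ?_, ?_⟩
  · rw [Ne, Measure.map_eq_zero_iff hTc.aemeasurable, ← Measure.measure_univ_eq_zero,
      ← univ_prod_univ, Measure.prod_prod, mul_eq_zero, not_or,
      Measure.measure_univ_eq_zero, Measure.measure_univ_eq_zero]
    exact ⟨hτ1, hζ0⟩
  · refine (ae_map_iff hSc.aemeasurable (p := fun y => y ∈ Metric.ball x δ)
      Metric.isOpen_ball.measurableSet).2 ?_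
    filter_upwards [hηae] with z hz using hin R ⟨hR0, le_rfl⟩ z hz
  · refine (ae_map_iff hTc.aemeasurable (p := fun y => y ∈ Metric.ball x δ)
      Metric.isOpen_ball.measurableSet).2 ?_
    filter_upwards [hprod τ ζ hτ hζae] with q hq using hin _ hq.1 _ hq.2
  · intro φ hφ
    have hφ1 : ContDiff ℝ 1 (fderiv ℝ φ) := hφ.1.fderiv_right (by norm_num)
    have hφ1c : Continuous (fderiv ℝ φ) := hφ1.continuous
    have hφ2c : Continuous (fderiv ℝ (fderiv ℝ φ)) := hφ1.continuous_fderiv (by norm_num)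
    have hφd : Differentiable ℝ φ := hφ.1.differentiable (by norm_num)
    have hφ1d : Differentiable ℝ (fderiv ℝ φ) := hφ1.differentiable (by norm_num)
    have hQc : Continuous fun y => (1/2 : ℝ) *
        frob (hess φ y) (∑ i, Matrix.vecMulVec (v i) (star (v i))) :=
      continuous_const.mul ((frob_continuous_left _).comp (hess_continuous hφ.1))
    rw [integral_map hTc.aemeasurable hQc.aestronglyMeasurable,
      integral_map hSc.aemeasurable hφ.1.continuous.aestronglyMeasurable]
    simp only [frob_hess_sum, ← hw]
    have hKp := (isCompact_Icc (a := (0:ℝ)) (b := R)).prod (isCompact_closedBall (0 : Ed n) 1)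
    rw [integral_prod _ (integrable_of_cont_compact (τ.prod ζ) _ hKp
      (by filter_upwards [hprod τ ζ hτ hζae] with q hq using ⟨Ioc_subset_Icc_self hq.1, hq.2⟩) _
      (by fun_prop))]
    rw [integral_withDensity_eq_integral_toReal_smul (by fun_prop)
      (Eventually.of_forall fun _ => ENNReal.ofReal_lt_top)]
    have step : ∀ r ∈ Ioc 0 R, (ENNReal.ofReal (2 * r)).toReal •
        ∫ z, (1/2 : ℝ) * ∑ k, fderiv ℝ (fderiv ℝ φ) (x + r • b z) (w k) (w k) ∂ζ =
        ∫ z, fderiv ℝ φ (x + r • b z) (b z) ∂η := by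
      intro r hr
      rw [ENNReal.toReal_ofReal (by have := hr.1; linarith), smul_eq_mul, integral_const_mul]
      rw [integral_finsetSum _ (fun k _ => integrable_of_cont_compact ζ _
        (isCompact_closedBall (0 : Ed n) 1) hζae _ (by fun_prop))]
      have e : ∀ z, fderiv ℝ φ (x + r • b z) (b z) = ∑ k, fderiv ℝ φ (x + r • b z) (w k) * z k := by
        intro z
        conv_lhs => rw [show b z = ∑ k, z k • w k from hb z]
        simp only [map_sum, map_smul, smul_eq_mul]
        rw [← hb z]
        exact Finset.sum_congr rfl fun k _ => mul_comm _ _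
      simp only [e]
      rw [integral_finsetSum _ (fun k _ => integrable_of_cont_compact η _
        (isCompact_closedBall (0 : Ed n) 1) hηae _ (by fun_prop)), Finset.mul_sum, Finset.mul_sum]
      refine Finset.sum_congr rfl fun k _ => ?_
      have hu : ContDiff ℝ 1 fun z : Ed n => fderiv ℝ φ (x + r • b z) (w k) := by
        refine (hφ1.comp ?_).clm_apply contDiff_const
        fun_prop
      rw [hIBP k _ hu, ← mul_assoc, ← integral_const_mul]
      congr 1
      ext z
      have hd1 : HasFDerivAt (fun z : Ed n => x + r • b z) (r • b) z :=
        (b.hasFDerivAt.const_smul r).const_add x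
      have hd2 := ((hφ1d (x + r • b z)).hasFDerivAt.comp z hd1).clm_apply
        (hasFDerivAt_const (w k) z)
      have := hd2.fderiv
      simp only [Function.comp_def] at this
      rw [this]
      simp [hbs]
      left
      ring
    have e1 : ∫ r, (ENNReal.ofReal (2 * r)).toReal •
        ∫ z, (1/2 : ℝ) * ∑ k, fderiv ℝ (fderiv ℝ φ) (x + r • b z) (w k) (w k) ∂ζ ∂τ0 =
        ∫ r, ∫ z, fderiv ℝ φ (x + r • b z) (b z) ∂η ∂τ0 := by
      refine integral_congr_ae ?_
      filter_upwards [hτ0] with r hr using step r hr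
    refine e1.trans ?_
    rw [integral_integral_swap (integrable_of_cont_compact (τ0.prod η) _ hKp
      (by filter_upwards [hprod τ0 η hτ0 hηae] with q hq using ⟨Ioc_subset_Icc_self hq.1, hq.2⟩) _
      (by simp only [Function.uncurry_def]; fun_prop))]
    have e2 : ∀ z, ∫ r, fderiv ℝ φ (x + r • b z) (b z) ∂τ0 = φ (x + R • b z) - φ x := by
      intro z
      simp only [τ0]
      rw [← intervalIntegral.integral_of_le hR0.le]
      have := intervalIntegral.integral_eq_sub_of_hasDerivAt (a := 0) (b := R)
        (f := fun r : ℝ => φ (x + r • b z)) (f' := fun r => fderiv ℝ φ (x + r • b z) (b z))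
        (fun r _ => by
          have h1 : HasDerivAt (fun r : ℝ => x + r • b z) (b z) r := by
            simpa using ((hasDerivAt_id r).smul_const (b z)).const_add x
          exact (hφd _).hasFDerivAt.comp_hasDerivAt r h1)
        (Continuous.intervalIntegrable (by fun_prop) _ _)
      rw [this]; simp
    simp only [e2]
    have hI := (integrable_of_cont_compact η _ (isCompact_closedBall (0 : Ed n) 1) hηae _
      (hφ.1.continuous.comp hSc))
    simp only [Function.comp_def] at hI
    rw [integral_sub hI (integrable_const _)]
    simp

theorem D_of_GEq {d : ℕ} (f : Matd d → ℝ≥0∞) (hA1 : CostA1 f) (Ω X : Set (Ed d))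
    (hΩ : IsOpen Ω) (hX : X = closure Ω)
    (ψ : Ed d → ℝ) (hψ : IsC2c ψ) (hG : GEq f X (fun y => -ψ y) Ω) :
    ∀ x ∈ X, (1/2 : ℝ) • hess ψ x ∈ domFstar f := by
  have hΩX : Ω ⊆ X := hX ▸ subset_closure
  have hQc : ∀ M, Continuous fun y => (1/2 : ℝ) * frob (hess ψ y) M := fun M =>
    continuous_const.mul ((frob_continuous_left _).comp (hess_continuous hψ.1))
  have main : ∀ x ∈ Ω, ∀ M, f M ≠ ⊤ → (1/2 : ℝ) * frob (hess ψ x) M ≤ (f M).toReal := by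
    intro x hx M hM
    by_contra hlt
    push Not at hlt
    obtain ⟨a, ha1, ha2⟩ := exists_between hlt
    have hnh : {y | a < (1/2 : ℝ) * frob (hess ψ y) M} ∩ Ω ∈ 𝓝 x :=
      inter_mem ((hQc M).continuousAt.eventually (lt_mem_nhds ha2)) (hΩ.mem_nhds hx)
    obtain ⟨δ, hδ, hball⟩ := Metric.mem_nhds_iff.1 hnh
    obtain ⟨p, m, hp, hm, hm0, hpb, hmb, hφ⟩ := ball_competitor x M (hA1.1 M hM) δ hδ
    have hpX : p Xᶜ = 0 := by
      have : ∀ᵐ y ∂p, y ∈ X := by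
        filter_upwards [hpb] with y hy using hΩX (hball hy).2
      exact this
    have hmX : m Xᶜ = 0 := by
      have : ∀ᵐ y ∂m, y ∈ X := by
        filter_upwards [hmb] with y hy using hΩX (hball hy).2
      exact this
    have hcomp : IsStaticCompetitor X (Measure.dirac x) p m (fun _ => M) :=
      ⟨hm, hmX, fun _ => hA1.1 M hM, fun φ h => by rw [hφ φ h]; simp⟩
    have hGc : Gcost f X x p ≤ f M * m univ :=
      sInf_le ⟨m, fun _ => M, hcomp, by simp⟩
    have h1 : ((-ψ x : ℝ) : EReal) ≤ ((∫ y, -ψ y ∂p : ℝ) : EReal) + (Gcost f X x p : EReal) := by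
      rw [← hG x hx]
      exact sInf_le ⟨p, hp, hpX, rfl⟩
    have hfin : f M * m univ ≠ ⊤ := ENNReal.mul_ne_top hM (measure_ne_top _ _)
    have hGfin : Gcost f X x p ≠ ⊤ := ne_top_of_le_ne_top hfin hGc
    have hGc' : (Gcost f X x p).toReal ≤ (f M).toReal * m.real univ := by
      have := ENNReal.toReal_mono hfin hGc
      rwa [ENNReal.toReal_mul] at this
    have h2 : -ψ x ≤ ∫ y, -ψ y ∂p + (Gcost f X x p).toReal := by
      rw [← EReal.coe_le_coe_iff, EReal.coe_add, EReal.coe_ennreal_toReal hGfin]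
      exact h1
    rw [integral_neg] at h2
    have h3 := hφ ψ hψ
    have hci : Integrable (fun y => (1/2 : ℝ) * frob (hess ψ y) M) m :=
      integrable_of_cont_compact m _ (isCompact_closedBall x δ)
        (by filter_upwards [hmb] with y hy using Metric.ball_subset_closedBall hy) _ (hQc M)
    have h4 : ∫ y, a ∂m ≤ ∫ y, (1/2 : ℝ) * frob (hess ψ y) M ∂m := by
      refine integral_mono_ae (integrable_const _) hci ?_
      filter_upwards [hmb] with y hy using (hball hy).1.le
    have hmpos : 0 < m.real univ := by
      rw [measureReal_def, ENNReal.toReal_pos_iff]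
      exact ⟨by rwa [pos_iff_ne_zero, Ne, Measure.measure_univ_eq_zero], measure_lt_top _ _⟩
    simp only [integral_const, smul_eq_mul] at h4
    nlinarith
  intro x hx M hM
  rw [frob_smul_left]
  refine ENNReal.ofReal_le_of_le_toReal ?_
  have hcl : IsClosed {y | (1/2 : ℝ) * frob (hess ψ y) M ≤ (f M).toReal} :=
    isClosed_le (hQc M) continuous_const
  rw [hX] at hx
  exact closure_minimal (fun y hy => main y hy M hM) hcl hx

theorem mem_D_iff {d : ℕ} (f : Matd d → ℝ≥0∞) (A : Matd d) :
    A ∈ domFstar f ↔ ∀ M, f M ≠ ⊤ → frob A M ≤ (f M).toReal := by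
  refine forall₂_congr fun M hM => ?_
  exact ENNReal.ofReal_le_iff_le_toReal hM

theorem D_convex {d : ℕ} (f : Matd d → ℝ≥0∞) : Convex ℝ (domFstar f) := by
  intro A hA B hB a b ha hb hab
  rw [mem_D_iff] at *
  intro M hM
  rw [frob_add_left, frob_smul_left, frob_smul_left]
  have h1 := mul_le_mul_of_nonneg_left (hA M hM) ha
  have h2 := mul_le_mul_of_nonneg_left (hB M hM) hb
  have : a * (f M).toReal + b * (f M).toReal = (f M).toReal := by rw [← add_mul, hab, one_mul]
  linarith

theorem D_zero {d : ℕ} (f : Matd d → ℝ≥0∞) : (0 : Matd d) ∈ domFstar f := by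
  intro M _
  simp [frob]

theorem D_of_small {d : ℕ} (f : Matd d → ℝ≥0∞) (c : ℝ)
    (hc : ∀ M, ENNReal.ofReal (c * matnorm M) ≤ f M) (A : Matd d) (hA : matnorm A ≤ c) :
    A ∈ domFstar f := by
  intro M _
  refine (ENNReal.ofReal_le_ofReal ?_).trans (hc M)
  have h1 : frob A M ≤ matnorm A * matnorm M := by
    have := Real.sum_mul_le_sqrt_mul_sqrt (Finset.univ : Finset (Fin d × Fin d))
      (fun p => A p.1 p.2) (fun p => M p.1 p.2)
    simp only [Fintype.sum_prod_type] at this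
    simpa [frob, matnorm, sq] using this
  exact h1.trans (mul_le_mul_of_nonneg_right hA (Real.sqrt_nonneg _))

theorem bicon {d : ℕ} (f : Matd d → ℝ≥0∞) (hA1 : CostA1 f) (hA2 : CostA2 f) (M0 : Matd d) (s : ℝ)
    (hs : 0 ≤ s) (h : ENNReal.ofReal s < f M0) : ∃ A ∈ domFstar f, s < frob A M0 := by
  obtain ⟨_, _, hsub, hhom⟩ := hA1
  have hf0 : f 0 = 0 := by simpa using hhom 0 le_rfl 0
  haveI : LocallyConvexSpace ℝ (Matd d) :=
    inferInstanceAs (LocallyConvexSpace ℝ (Fin d → Fin d → ℝ))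
  let epi : Set ((Matd d) × ℝ) := {q | f q.1 ≤ ENNReal.ofReal q.2 ∧ 0 ≤ q.2}
  have hcl : IsClosed epi := by
    refine IsClosed.inter ?_ (isClosed_le continuous_const continuous_snd)
    have h1 : IsClosed {p : Matd d × ℝ≥0∞ | f p.1 ≤ p.2} :=
      LowerSemicontinuous.isClosed_epigraph hA2
    have h2 : Continuous fun q : (Matd d) × ℝ =>
        ((q.1 : Matd d), ENNReal.ofReal q.2) :=
      Continuous.prodMk (continuous_fst (X := Matd d)) (ENNReal.continuous_ofReal.comp continuous_snd)
    exact h1.preimage h2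
  have hcone : ∀ t : ℝ, 0 ≤ t → ∀ q ∈ epi, t • q ∈ epi := by
    intro t ht q hq
    refine ⟨?_, mul_nonneg ht hq.2⟩
    change f (t • (q.1 : Matd d)) ≤ ENNReal.ofReal (t * q.2)
    rw [hhom t ht, ENNReal.ofReal_mul ht]
    gcongr
    exact hq.1
  have hadd : ∀ q ∈ epi, ∀ q' ∈ epi, q + q' ∈ epi := by
    intro q hq q' hq'
    refine ⟨?_, add_nonneg hq.2 hq'.2⟩
    change f ((q.1 : Matd d) + q'.1) ≤ ENNReal.ofReal (q.2 + q'.2)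
    rw [ENNReal.ofReal_add hq.2 hq'.2]
    exact (hsub _ _).trans (add_le_add hq.1 hq'.1)
  have hconv : Convex ℝ epi := fun q hq q' hq' a b ha hb _ =>
    hadd _ (hcone a ha q hq) _ (hcone b hb q' hq')
  have hnot : ((M0, s) : (Matd d) × ℝ) ∉ epi := fun hh => absurd hh.1 (not_le.2 h)
  obtain ⟨l, u, hl1, hl2⟩ := geometric_hahn_banach_closed_point hconv hcl hnot
  have hz : (0 : (Matd d) × ℝ) ∈ epi := by
    refine ⟨?_, le_rfl⟩
    change f (0 : Matd d) ≤ _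
    rw [hf0]; exact zero_le
  have hu : 0 < u := by simpa using hl1 0 hz
  have hneg : ∀ q ∈ epi, l q ≤ 0 := by
    intro q hq
    by_contra hp
    push Not at hp
    have := hl1 _ (hcone (u / l q) (by positivity) q hq)
    rw [map_smul, smul_eq_mul, div_mul_cancel₀ _ hp.ne'] at this
    exact lt_irrefl _ this
  obtain ⟨A, hA⟩ : ∃ A : Matd d, ∀ M : Matd d, frob A M = l ((M : Matd d), 0) := by
    refine ⟨Matrix.of fun i j => l (Matrix.single i j 1, 0), fun M => ?_⟩
    have hM : ((M : Matd d), (0:ℝ)) =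
        ∑ i, ∑ j, (M i j) • ((Matrix.single i j (1:ℝ) : Matd d), (0:ℝ)) := by
      refine Prod.ext ?_ ?_
      · simp only [Prod.fst_sum, Prod.smul_fst]
        conv_lhs => rw [Matrix.matrix_eq_sum_single M]
        simp [Matrix.smul_single]
      · simp [Prod.snd_sum]
    rw [hM]
    simp only [map_sum, map_smul, smul_eq_mul, frob, Matrix.of_apply]
    exact Finset.sum_congr rfl fun i _ => Finset.sum_congr rfl fun j _ => mul_comm _ _
  obtain ⟨τ, hτ⟩ : ∃ τ : ℝ, τ = - l (0, 1) := ⟨_, rfl⟩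
  have hl : ∀ (M : Matd d) (r : ℝ), l ((M : Matd d), r) = frob A M - τ * r := by
    intro M r
    rw [hA, hτ]
    have : ((M : Matd d), r) = ((M : Matd d), (0:ℝ)) + r • ((0 : Matd d), (1:ℝ)) := by
      simp
    rw [this, map_add, map_smul, smul_eq_mul]; ring
  have hτ0 : 0 ≤ τ := by
    have := hneg ((0 : Matd d), 1) ⟨by change f (0 : Matd d) ≤ _; rw [hf0]; exact zero_le, zero_le_one⟩
    rw [hτ]; linarith
  have hdom : ∀ M, f M ≠ ⊤ → frob A M ≤ τ * (f M).toReal := by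
    intro M hM
    have := hneg ((M : Matd d), (f M).toReal)
      ⟨by change f M ≤ _; rw [ENNReal.ofReal_toReal hM], ENNReal.toReal_nonneg⟩
    rw [hl] at this
    linarith
  have hM0 : τ * s < frob A M0 := by
    have := hl2
    rw [hl] at this
    linarith
  rcases hτ0.eq_or_lt with h0 | hpos
  · have hp : 0 < frob A M0 := by rw [← h0] at hM0; simpa using hM0
    refine ⟨((s + 1) / frob A M0) • A, ?_, ?_⟩
    · rw [mem_D_iff]
      intro M hM
      have h1 := hdom M hM
      rw [← h0, zero_mul] at h1
      rw [frob_smul_left]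
      exact (mul_nonpos_of_nonneg_of_nonpos (by positivity) h1).trans ENNReal.toReal_nonneg
    · rw [frob_smul_left, div_mul_cancel₀ _ hp.ne']; linarith
  · refine ⟨τ⁻¹ • A, ?_, ?_⟩
    · rw [mem_D_iff]
      intro M hM
      rw [frob_smul_left, inv_mul_le_iff₀ hpos]
      exact hdom M hM
    · rw [frob_smul_left, lt_inv_mul_iff₀ hpos]
      exact hM0

/-- countable family in the dual domain recovering `f`. -/
theorem bicon_seq {d : ℕ} (f : Matd d → ℝ≥0∞) (hA1 : CostA1 f) (hA2 : CostA2 f) :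
    ∃ a : ℕ → Matd d, (∀ n, a n ∈ domFstar f) ∧
      ∀ M, f M ≤ ⨆ n, ENNReal.ofReal (frob (a n) M) := by
  have : SecondCountableTopology (Matd d) :=
    inferInstanceAs (SecondCountableTopology (Fin d → Fin d → ℝ))
  have : Nonempty (domFstar f) := ⟨⟨0, D_zero f⟩⟩
  obtain ⟨a, ha⟩ := TopologicalSpace.exists_dense_seq (domFstar f)
  refine ⟨fun n => (a n : Matd d), fun n => (a n).2, fun M => ?_⟩
  refine le_of_forall_lt fun t ht => ?_
  have htt : t ≠ ⊤ := (lt_of_lt_of_le ht le_top).ne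
  obtain ⟨A, hA, hlt⟩ := bicon f hA1 hA2 M t.toReal ENNReal.toReal_nonneg
    (by rwa [ENNReal.ofReal_toReal htt])
  have hop : IsOpen {B : domFstar f | t.toReal < frob (B : Matd d) M} :=
    isOpen_lt continuous_const ((frob_continuous_left M).comp continuous_subtype_val)
  obtain ⟨n, hn⟩ := ha.exists_mem_open hop ⟨⟨A, hA⟩, hlt⟩
  refine lt_of_lt_of_le ?_ (le_iSup _ n)
  rw [ENNReal.lt_ofReal_iff_toReal_lt htt]
  exact hn

theorem HB_abs {E W : Type*} [AddCommGroup E] [Module ℝ E] [AddCommGroup W] [Module ℝ W]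
    (T : W →ₗ[ℝ] E) (l : W →ₗ[ℝ] ℝ) (K : Set E) (hK : Convex ℝ K) (hKa : Absorbent ℝ K)
    (c : ℝ) (hc : 0 ≤ c) (H : ∀ w, T w ∈ K → l w ≤ c) :
    ∃ L : E →ₗ[ℝ] ℝ, (∀ A ∈ K, L A ≤ c) ∧ ∀ w, L (T w) = l w := by
  have h0K : (0 : E) ∈ K := hKa.zero_mem
  have hker : ∀ w, T w = 0 → l w = 0 := by
    intro w hw
    by_contra hne
    have := H (((c + 1) / l w) • w) (by rw [map_smul, hw, smul_zero]; exact h0K)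
    rw [map_smul, smul_eq_mul, div_mul_cancel₀ _ hne] at this
    linarith
  obtain ⟨s, hs⟩ := LinearMap.exists_rightInverse_of_surjective T.rangeRestrict
    (LinearMap.range_rangeRestrict T)
  have hs' : ∀ x : LinearMap.range T, T (s x) = x := fun x => by
    have := LinearMap.congr_fun hs x
    exact congrArg Subtype.val this
  obtain ⟨L, hL1, hL2⟩ := exists_extension_of_le_sublinear
    (⟨LinearMap.range T, l ∘ₗ s⟩ : E →ₗ.[ℝ] ℝ) (fun x => c * gauge K x)
    (by
      intro t ht x
      have := gauge_smul_of_nonneg (s := K) ht.le x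
      simp only [this, smul_eq_mul]; ring)
    (by
      intro x y
      have := gauge_add_le hK hKa x y
      rw [← mul_add]
      exact mul_le_mul_of_nonneg_left this hc)
    (by
      rintro x
      change l (s x) ≤ c * gauge K x
      by_contra hlt
      push Not at hlt
      set g := gauge K (x : E) with hg
      set e := (l (s x) - c * g) / (c + 1) with he
      have hepos : 0 < e := div_pos (by linarith) (by linarith)
      obtain ⟨b, hb0, hba, hxb⟩ := exists_lt_of_gauge_lt hKa (show gauge K (x : E) < g + e by linarith)
      have hm : b⁻¹ • (x : E) ∈ K := (Set.mem_smul_set_iff_inv_smul_mem₀ hb0.ne' _ _).1 hxb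
      have h1 := H (b⁻¹ • s x) (by rw [map_smul, hs' x]; exact hm)
      rw [map_smul, smul_eq_mul, inv_mul_le_iff₀ hb0] at h1
      have h2 : b * c ≤ (g + e) * c := mul_le_mul_of_nonneg_right hba.le hc
      have h3 : e * (c + 1) = l (s x) - c * g := div_mul_cancel₀ _ (by linarith)
      nlinarith)
  refine ⟨L, fun A hA => ?_, fun w => ?_⟩
  · have := hL2 A
    have h1 := gauge_le_one_of_mem hA
    have := mul_le_mul_of_nonneg_left h1 hc
    linarith [hL2 A]
  · have h1 := hL1 (T.rangeRestrict w)
    change L (T w) = l (s (T.rangeRestrict w)) at h1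
    rw [h1]
    have h2 := hker (s (T.rangeRestrict w) - w) (by rw [map_sub, hs' _]; simp)
    rw [map_sub] at h2
    linarith

theorem hess_add {d : ℕ} (φ ψ : Ed d → ℝ) (h1 : ContDiff ℝ 2 φ) (h2 : ContDiff ℝ 2 ψ) (x : Ed d) :
    hess (φ + ψ) x = hess φ x + hess ψ x := by
  ext i j
  simp only [hess, Matrix.add_apply]
  rw [iteratedFDeriv_add_apply h1.contDiffAt h2.contDiffAt]
  rfl

theorem hess_smul {d : ℕ} (t : ℝ) (φ : Ed d → ℝ) (h1 : ContDiff ℝ 2 φ) (x : Ed d) :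
    hess (t • φ) x = t • hess φ x := by
  ext i j
  simp only [hess, Matrix.smul_apply]
  rw [iteratedFDeriv_const_smul_apply h1.contDiffAt]
  rfl

/-- the space of C2c functions -/
def C2cSub (d : ℕ) : Submodule ℝ (Ed d → ℝ) where
  carrier := {φ | IsC2c φ}
  zero_mem' := ⟨contDiff_const, HasCompactSupport.zero⟩
  add_mem' := fun ha hb => ⟨ha.1.add hb.1, ha.2.add hb.2⟩
  smul_mem' := fun t φ h => ⟨contDiff_const.smul h.1, h.2.smul_left (f := fun _ => t)⟩

theorem HB_D {d : ℕ} (f : Matd d → ℝ≥0∞) (hA1 : CostA1 f) (X : Set (Ed d)) (hXc : IsCompact X)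
    (μ ν : Measure (Ed d)) [IsFiniteMeasure μ] [IsFiniteMeasure ν] (c : ℝ) (hc : 0 ≤ c)
    (H : ∀ ψ, IsC2c ψ → (∀ x ∈ X, (1/2:ℝ) • hess ψ x ∈ domFstar f) →
      ∫ x, ψ x ∂ν - ∫ x, ψ x ∂μ ≤ c) :
    ∃ L : C(X, Matd d) →ₗ[ℝ] ℝ, (∀ A : C(X, Matd d), (∀ x, A x ∈ domFstar f) → L A ≤ c) ∧
      ∀ φ, IsC2c φ → ∀ A : C(X, Matd d), (∀ x : X, A x = (1/2:ℝ) • hess φ x) →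
        L A = ∫ x, φ x ∂ν - ∫ x, φ x ∂μ := by
  haveI : CompactSpace X := isCompact_iff_compactSpace.1 hXc
  have hint : ∀ (m : Measure (Ed d)) [IsFiniteMeasure m] (φ : C2cSub d), Integrable φ.1 m :=
    fun m _ φ => φ.2.1.continuous.integrable_of_hasCompactSupport φ.2.2
  let T : C2cSub d →ₗ[ℝ] C(X, Matd d) :=
    { toFun := fun φ => ⟨fun x => (1/2:ℝ) • hess φ.1 x,
        show Continuous ((1/2:ℝ) • (hess φ.1 ∘ Subtype.val)) from
          ((hess_continuous φ.2.1).comp continuous_subtype_val).const_smul _⟩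
      map_add' := by
        intro φ ψ
        ext1 x
        change (1/2:ℝ) • hess (φ.1 + ψ.1) x = (1/2:ℝ) • hess φ.1 x + (1/2:ℝ) • hess ψ.1 x
        rw [hess_add _ _ φ.2.1 ψ.2.1, smul_add]
      map_smul' := by
        intro t φ
        ext1 x
        change (1/2:ℝ) • hess (t • φ.1) x = t • (1/2:ℝ) • hess φ.1 x
        rw [hess_smul _ _ φ.2.1, smul_comm] }
  let l : C2cSub d →ₗ[ℝ] ℝ :=
    { toFun := fun φ => ∫ x, φ.1 x ∂ν - ∫ x, φ.1 x ∂μ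
      map_add' := by
        intro φ ψ
        change ∫ x, (φ.1 x + ψ.1 x) ∂ν - ∫ x, (φ.1 x + ψ.1 x) ∂μ = _
        rw [integral_add (hint _ φ) (hint _ ψ), integral_add (hint _ φ) (hint _ ψ)]
        ring
      map_smul' := by
        intro t φ
        change ∫ x, (t * φ.1 x) ∂ν - ∫ x, (t * φ.1 x) ∂μ = t * _
        rw [integral_const_mul, integral_const_mul]
        ring }
  obtain ⟨c0, hc0, hcoer⟩ := hA1.2.1
  obtain ⟨L, h1, h2⟩ := HB_abs T l {A | ∀ x, A x ∈ domFstar f}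
    (fun A hA B hB a b ha hb hab x => D_convex f (hA x) (hB x) ha hb hab)
    (by
      intro A
      have hmc : Continuous fun x : X => matnorm (A x) :=
        Real.continuous_sqrt.comp (frob_continuous.comp (A.continuous.prodMk A.continuous))
      obtain ⟨R, hR⟩ := (isCompact_range hmc).bddAbove
      refine absorbs_iff_norm.2 ⟨(|R| + 1) / c0, fun t ht => ?_⟩
      have htpos : 0 < ‖t‖ := lt_of_lt_of_le (by positivity) ht
      have ht0 : t ≠ 0 := norm_pos_iff.1 htpos
      rw [Set.singleton_subset_iff, Set.mem_smul_set_iff_inv_smul_mem₀ ht0]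
      intro x
      refine D_of_small f c0 hcoer _ ?_
      change matnorm (t⁻¹ • A x) ≤ c0
      have hx : matnorm (A x) ≤ R := hR ⟨x, rfl⟩
      have e1 : matnorm (t⁻¹ • A x) = ‖t‖⁻¹ * matnorm (A x) := by
        unfold matnorm
        rw [frob_smul_left, frob_smul_right, ← mul_assoc, Real.sqrt_mul (mul_self_nonneg _),
          Real.sqrt_mul_self_eq_abs, abs_inv]
        rfl
      rw [e1, inv_mul_le_iff₀ htpos]
      have h5 : |R| + 1 ≤ ‖t‖ * c0 := (div_le_iff₀ hc0).1 ht
      linarith [le_abs_self R])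
    c hc (fun w hw => H w.1 w.2 fun x hx => hw ⟨x, hx⟩)
  refine ⟨L, h1, fun φ hφ A hA => ?_⟩
  rw [← show l ⟨φ, hφ⟩ = ∫ x, φ x ∂ν - ∫ x, φ x ∂μ from rfl, ← h2]
  congr 1
  ext1 x
  exact hA x

theorem riesz_v {d : ℕ} (f : Matd d → ℝ≥0∞) (hA1 : CostA1 f) (X : Set (Ed d)) (hXc : IsCompact X)
    (L : C(X, Matd d) →ₗ[ℝ] ℝ)
    (hker : ∀ A : C(X, Matd d), (∀ x M, f M ≠ ⊤ → frob (A x) M ≤ 0) → L A ≤ 0)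
    (v : Fin d → ℝ) :
    ∃ n : Measure (Ed d), IsFiniteMeasure n ∧ n Xᶜ = 0 ∧ ∀ g : Ed d → ℝ, Continuous g →
      ∀ A : C(X, Matd d), (∀ x : X, A x = g x • Matrix.vecMulVec v v) → L A = ∫ x, g x ∂n := by
  haveI : CompactSpace X := isCompact_iff_compactSpace.1 hXc
  obtain ⟨B, hB⟩ : ∃ B : Matd d, B = Matrix.vecMulVec v v := ⟨_, rfl⟩
  have hBpos : ∀ M, f M ≠ ⊤ → 0 ≤ frob B M := by
    intro M hM
    have h := (hA1.1 M hM).dotProduct_mulVec_nonneg v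
    have : frob B M = star v ⬝ᵥ M.mulVec v := by
      simp only [frob, hB, Matrix.vecMulVec_apply, dotProduct, Matrix.mulVec, Finset.mul_sum]
      refine Finset.sum_congr rfl fun i _ => Finset.sum_congr rfl fun j _ => ?_
      simp; ring
    rw [this]; exact h
  rw [← hB]
  let emb : CompactlySupportedContinuousMap X ℝ →ₗ[ℝ] C(X, Matd d) :=
    { toFun := fun g => ⟨fun x => g x • B, g.continuous.smul continuous_const⟩
      map_add' := fun g h => by
        ext1 x
        exact add_smul (g x) (h x) B
      map_smul' := fun t g => by
        ext1 x
        exact mul_smul t (g x) B }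
  let Λ : CompactlySupportedContinuousMap X ℝ →ₚ[ℝ] ℝ :=
    PositiveLinearMap.mk₀ (L ∘ₗ emb) (by
      intro g hg
      have h1 : L (-(emb g)) ≤ 0 := by
        refine hker _ fun x M hM => ?_
        change frob (-(g x • B)) M ≤ 0
        rw [← neg_smul, frob_smul_left]
        have h2 : 0 ≤ g x := hg x
        nlinarith [mul_nonneg h2 (hBpos M hM)]
      rw [map_neg] at h1
      change 0 ≤ L (emb g)
      linarith)
  have hval : Measurable (Subtype.val : X → Ed d) := measurable_subtype_coe
  refine ⟨(RealRMK.rieszMeasure Λ).map Subtype.val, inferInstance, ?_, ?_⟩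
  · rw [Measure.map_apply hval hXc.isClosed.measurableSet.compl]
    have : (Subtype.val : X → Ed d) ⁻¹' Xᶜ = ∅ := by
      ext x; simp
    rw [this]; simp
  · intro g hg A hA
    rw [integral_map hval.aemeasurable hg.aestronglyMeasurable]
    let g' : CompactlySupportedContinuousMap X ℝ :=
      ⟨⟨fun x => g x, hg.comp continuous_subtype_val⟩, HasCompactSupport.of_compactSpace _⟩
    have h := RealRMK.integral_rieszMeasure Λ g'
    change ∫ x : X, g x ∂_ = L (emb g') at h
    rw [h]
    congr 1
    ext1 x
    exact hA x

theorem ker_of_bound {d : ℕ} (f : Matd d → ℝ≥0∞) (X : Set (Ed d)) (c : ℝ) (hc : 0 ≤ c)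
    (L : C(X, Matd d) →ₗ[ℝ] ℝ)
    (hL : ∀ A : C(X, Matd d), (∀ x, A x ∈ domFstar f) → L A ≤ c)
    (A : C(X, Matd d)) (hA : ∀ x M, f M ≠ ⊤ → frob (A x) M ≤ 0) : L A ≤ 0 := by
  by_contra hne
  push Not at hne
  have := hL (((c + 1) / L A) • A) (fun x => by
    rw [mem_D_iff]
    intro M hM
    change frob (((c + 1) / L A) • A x) M ≤ _
    rw [frob_smul_left]
    have h1 : 0 ≤ (c + 1) / L A := by positivity
    have h2 := mul_nonneg h1 (neg_nonneg.2 (hA x M hM))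
    have h3 : 0 ≤ (f M).toReal := ENNReal.toReal_nonneg
    linarith)
  rw [map_smul, smul_eq_mul, div_mul_cancel₀ _ hne.ne'] at this
  linarith

theorem riesz_L {d : ℕ} (f : Matd d → ℝ≥0∞) (hA1 : CostA1 f) (X : Set (Ed d)) (hXc : IsCompact X)
    (L : C(X, Matd d) →ₗ[ℝ] ℝ)
    (hker : ∀ A : C(X, Matd d), (∀ x M, f M ≠ ⊤ → frob (A x) M ≤ 0) → L A ≤ 0) :
    ∃ (m : Measure (Ed d)) (ρ : Ed d → Matd d), IsFiniteMeasure m ∧ m Xᶜ = 0 ∧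
      (∀ i j, Measurable fun x => ρ x i j) ∧ (∀ i j, Integrable (fun x => ρ x i j) m) ∧
      ∀ A : Ed d → Matd d, Continuous A → ∀ A' : C(X, Matd d), (∀ x : X, A' x = A x) →
        L A' = ∫ x, frob (A x) (ρ x) ∂m := by
  obtain ⟨v, hv⟩ : ∃ v : Fin d → Fin d → Fin d → ℝ, ∀ i j k,
    v i j k = (if k = i then 1 else 0) + (if k = j then 1 else 0) := ⟨_, fun _ _ _ => rfl⟩
  choose n hnfin hnX hn using fun i j => riesz_v f hA1 X hXc L hker (v i j)
  obtain ⟨m, hm⟩ : ∃ m : Measure (Ed d), m = ∑ i, ∑ j, n i j := ⟨_, rfl⟩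
  have hmfin : IsFiniteMeasure m := by
    rw [hm]
    infer_instance
  have hle : ∀ i j, n i j ≤ m := by
    intro i j
    rw [hm]
    refine le_trans ?_ (Finset.single_le_sum (f := fun i => ∑ j, n i j) (fun _ _ => Measure.zero_le _) (Finset.mem_univ i))
    exact Finset.single_le_sum (f := fun j => n i j) (fun _ _ => Measure.zero_le _) (Finset.mem_univ j)
  have hac : ∀ i j, n i j ≪ m := fun i j => (hle i j).absolutelyContinuous
  obtain ⟨w, hw⟩ : ∃ w : Fin d → Fin d → Ed d → ℝ, ∀ i j x,
    w i j x = ((n i j).rnDeriv m x).toReal := ⟨_, fun _ _ _ => rfl⟩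
  have hwm : ∀ i j, Measurable (w i j) := by
    intro i j
    have : w i j = fun x => ((n i j).rnDeriv m x).toReal := funext (hw i j)
    rw [this]
    exact (Measure.measurable_rnDeriv _ _).ennreal_toReal
  have hwi : ∀ i j, Integrable (w i j) m := by
    intro i j
    have : w i j = fun x => ((n i j).rnDeriv m x).toReal := funext (hw i j)
    rw [this]
    exact Measure.integrable_toReal_rnDeriv
  have hmX : m Xᶜ = 0 := by
    rw [hm]
    simp [hnX]
  have hmae : ∀ᵐ x ∂m, x ∈ X := by
    rw [ae_iff]; exact hmX
  have hgi : ∀ (g : Ed d → ℝ), Continuous g → ∀ i j, Integrable (fun x => g x * w i j x) m := by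
    intro g hg i j
    obtain ⟨C, hC⟩ := hXc.exists_bound_of_continuousOn hg.continuousOn
    refine (hwi i j).bdd_mul (c := C) hg.aestronglyMeasurable ?_
    filter_upwards [hmae] with x hx using hC x hx
  have hgn : ∀ (g : Ed d → ℝ), Continuous g → ∀ i j, ∀ A : C(X, Matd d),
      (∀ x : X, A x = g x • Matrix.vecMulVec (v i j) (v i j)) → L A = ∫ x, g x * w i j x ∂m := by
    intro g hg i j A hA
    haveI : IsFiniteMeasure (n i j) := hnfin i j
    haveI : (n i j).HaveLebesgueDecomposition m := Measure.haveLebesgueDecomposition_of_sigmaFinite _ _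
    rw [hn i j g hg A hA, ← integral_toReal_rnDeriv_mul (hac i j)]
    refine integral_congr_ae (Eventually.of_forall fun x => ?_)
    simp only [hw]; ring
  refine ⟨m, fun x => fun i j => (1/2) * (w i j x - w i i x / 4 - w j j x / 4), hmfin, hmX, ?_, ?_, ?_⟩
  · intro i j
    exact (((hwm i j).sub ((hwm i i).div_const 4)).sub ((hwm j j).div_const 4)).const_mul _
  · intro i j
    exact (((hwi i j).sub ((hwi i i).div_const 4)).sub ((hwi j j).div_const 4)).const_mul _
  · intro A hA A' hA'
    have hAc : ∀ i j, Continuous fun x => A x i j := fun i j =>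
      (continuous_apply_apply (ρ := fun _ _ => ℝ) i j).comp hA
    -- continuous pieces
    obtain ⟨P, hP⟩ : ∃ P : Fin d → Fin d → Fin d → Fin d → C(X, Matd d), ∀ i j k l x,
        P i j k l x = A x i j • Matrix.vecMulVec (v k l) (v k l) :=
      ⟨fun i j k l => ⟨fun x => A x i j • Matrix.vecMulVec (v k l) (v k l),
        ((hAc i j).comp continuous_subtype_val).smul continuous_const⟩, fun _ _ _ _ _ => rfl⟩
    have hPL : ∀ i j k l, L (P i j k l) = ∫ x, A x i j * w k l x ∂m := fun i j k l =>
      hgn (fun x => A x i j) (hAc i j) k l _ (hP i j k l)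
    obtain ⟨S, hS⟩ : ∃ S : C(X, Matd d), S = ∑ i, ∑ j, (1/2 : ℝ) • (P i j i j - (1/4 : ℝ) • P i j i i
      - (1/4 : ℝ) • P i j j j) := ⟨_, rfl⟩
    have hSx : ∀ x : X, ∀ a b, S x a b = (A x a b + A x b a) / 2 := by
      intro x a b
      have e1 : S x a b = ∑ i, ∑ j, (1/2 : ℝ) * (A x i j * (v i j a * v i j b)
          - (1/4) * (A x i j * (v i i a * v i i b)) - (1/4) * (A x i j * (v j j a * v j j b))) := by
        rw [hS]
        simp only [ContinuousMap.sum_apply, ContinuousMap.smul_apply, ContinuousMap.sub_apply, hP,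
          Matrix.sum_apply, Matrix.smul_apply, Matrix.sub_apply, Matrix.vecMulVec_apply, smul_eq_mul]
      rw [e1]
      have e2 : ∀ i j, (1/2 : ℝ) * (A x i j * (v i j a * v i j b)
          - (1/4) * (A x i j * (v i i a * v i i b)) - (1/4) * (A x i j * (v j j a * v j j b)))
          = (if a = i then (if b = j then A x i j / 2 else 0) else 0)
            + (if b = i then (if a = j then A x i j / 2 else 0) else 0) := by
        intro i j
        simp only [hv]
        split_ifs <;> ring
      simp only [e2, Finset.sum_add_distrib]
      simp
      ring
    have hanti : ∀ x : X, ∀ M, f M ≠ ⊤ → frob ((A' - S) x) M = 0 := by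
      intro x M hM
      have hsym : ∀ i j, M i j = M j i := fun i j => by
        have := (hA1.1 M hM).isHermitian.apply j i
        simpa using this
      have e1 : ∀ i j, (A' - S) x i j = A x i j / 2 - A x j i / 2 := by
        intro i j
        rw [ContinuousMap.sub_apply, Matrix.sub_apply, hA', hSx]; ring
      simp only [frob, e1, sub_mul, Finset.sum_sub_distrib]
      rw [sub_eq_zero, Finset.sum_comm]
      refine Finset.sum_congr rfl fun i _ => Finset.sum_congr rfl fun j _ => ?_
      rw [hsym]
    have hz : L (A' - S) = 0 := by
      refine le_antisymm (hker _ fun x M hM => (hanti x M hM).le) ?_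
      have := hker (-(A' - S)) (fun x M hM => by
        change frob (-((A' - S) x)) M ≤ 0
        rw [← neg_one_smul ℝ, frob_smul_left, hanti x M hM]; simp)
      rw [map_neg] at this
      linarith
    rw [map_sub, sub_eq_zero] at hz
    rw [hz, hS]
    simp only [map_sum, map_smul, map_sub, hPL, smul_eq_mul]
    simp only [frob]
    have hI : ∀ i j, Integrable (fun x => A x i j * ((1/2) * (w i j x - w i i x / 4 - w j j x / 4))) m := by
      intro i j
      have := (((hgi _ (hAc i j) i j).sub ((hgi _ (hAc i j) i i).div_const 4)).sub
        ((hgi _ (hAc i j) j j).div_const 4)).const_mul (1/2)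
      refine this.congr (Eventually.of_forall fun x => ?_)
      simp only [Pi.sub_apply]; ring
    rw [integral_finsetSum _ fun i _ => integrable_finsetSum _ fun j _ => hI i j]
    refine Finset.sum_congr rfl fun i _ => ?_
    rw [integral_finsetSum _ fun j _ => hI i j]
    refine Finset.sum_congr rfl fun j _ => ?_
    have e3 : ∀ x, A x i j * ((1/2) * (w i j x - w i i x / 4 - w j j x / 4)) =
        (1/2) * (A x i j * w i j x - (1/4) * (A x i j * w i i x) - (1/4) * (A x i j * w j j x)) := by
      intro x; ring
    simp only [e3]
    rw [integral_const_mul, integral_sub, integral_sub, integral_const_mul, integral_const_mul]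
    · exact hgi _ (hAc i j) i j
    · exact (hgi _ (hAc i j) i i).const_mul _
    · exact (hgi _ (hAc i j) i j).sub ((hgi _ (hAc i j) i i).const_mul _)
    · exact (hgi _ (hAc i j) j j).const_mul _

theorem frob_sum_left {d : ℕ} {ι : Type*} (s : Finset ι) (w : ι → ℝ) (a : ι → Matd d) (M : Matd d) :
    frob (∑ k ∈ s, w k • a k) M = ∑ k ∈ s, w k * frob (a k) M := by
  induction s using Finset.induction_on with
  | empty => simp [frob]
  | insert k s hk ih => rw [Finset.sum_insert hk, Finset.sum_insert hk, frob_add_left, frob_smul_left, ih]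

theorem approx_le {d : ℕ} (f : Matd d → ℝ≥0∞) (m : Measure (Ed d)) [IsFiniteMeasure m]
    (ρ : Ed d → Matd d) (hρi : ∀ i j, Integrable (fun x => ρ x i j) m) (c : ℝ)
    (hc : ∀ A : Ed d → Matd d, Continuous A → (∀ x, A x ∈ domFstar f) →
      ∫ x, frob (A x) (ρ x) ∂m ≤ c)
    (N : ℕ) (a : ℕ → Matd d) (ha : ∀ k, a k ∈ domFstar f) (G : Ed d → ℕ → ℝ)
    (hGm : ∀ k, Measurable fun x => G x k) (hG0 : ∀ x k, 0 ≤ G x k)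
    (hG1 : ∀ x, ∑ k ∈ Finset.range N, G x k ≤ 1) :
    ∫ x, ∑ k ∈ Finset.range N, G x k * frob (a k) (ρ x) ∂m ≤ c := by
  have hqi : ∀ k, Integrable (fun x => frob (a k) (ρ x)) m := fun k =>
    integrable_finsetSum _ fun i _ => integrable_finsetSum _ fun j _ => (hρi i j).const_mul _
  -- vector valued version
  obtain ⟨V, hV⟩ : ∃ V : Ed d → Fin N → ℝ, ∀ x k, V x k = G x k := ⟨fun x k => G x k, fun _ _ => rfl⟩
  have hVm : Measurable V := by
    refine measurable_pi_iff.2 fun k => ?_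
    simp only [hV]; exact hGm k
  have hGle : ∀ x, ∀ k : Fin N, G x k ≤ 1 := fun x k =>
    (Finset.single_le_sum (f := fun k => G x k) (fun k _ => hG0 x k)
      (Finset.mem_range.2 k.2)).trans (hG1 x)
  have hVmem : MemLp V 1 m := by
    refine MemLp.of_bound hVm.aestronglyMeasurable 1 (Eventually.of_forall fun x => ?_)
    refine (pi_norm_le_iff_of_nonneg zero_le_one).2 fun k => ?_
    rw [hV, Real.norm_of_nonneg (hG0 _ _)]
    exact hGle x k
  have hex : ∀ n : ℕ, ∃ g : BoundedContinuousFunction (Ed d) (Fin N → ℝ),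
      eLpNorm (V - ⇑g) 1 m ≤ ENNReal.ofReal (1 / ((n:ℝ) + 1)) := fun n => by
    obtain ⟨g, hg, _⟩ := hVmem.exists_boundedContinuous_eLpNorm_sub_le (by simp)
      (ε := ENNReal.ofReal (1 / ((n:ℝ) + 1))) (by
        rw [Ne, ENNReal.ofReal_eq_zero, not_le]; positivity)
    exact ⟨g, hg⟩
  choose g hg using hex
  have htend : Tendsto (fun n => eLpNorm (⇑(g n) - V) 1 m) atTop (𝓝 0) := by
    have h1 : Tendsto (fun n : ℕ => ENNReal.ofReal (1 / ((n:ℝ) + 1))) atTop (𝓝 0) := by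
      have := ENNReal.tendsto_ofReal (tendsto_one_div_add_atTop_nhds_zero_nat (𝕜 := ℝ))
      simpa using this
    refine tendsto_of_tendsto_of_tendsto_of_le_of_le tendsto_const_nhds h1 (fun _ => zero_le) ?_
    intro n
    change eLpNorm (⇑(g n) - V) 1 m ≤ _
    rw [eLpNorm_sub_comm]
    exact hg n
  have hmeas := tendstoInMeasure_of_tendsto_eLpNorm (p := 1) one_ne_zero
    (fun n => (g n).continuous.aestronglyMeasurable) hVm.aestronglyMeasurable htend
  obtain ⟨ns, _, hae⟩ := hmeas.exists_seq_tendsto_ae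
  -- retraction
  obtain ⟨r, hr⟩ : ∃ r : (Fin N → ℝ) → Fin N → ℝ, ∀ t k,
    r t k = max (t k) 0 / max 1 (∑ j, max (t j) 0) := ⟨_, fun _ _ => rfl⟩
  have hden : ∀ t : Fin N → ℝ, 0 < max 1 (∑ j, max (t j) 0) := fun t => lt_max_of_lt_left one_pos
  have hrc : ∀ k, Continuous fun t => r t k := by
    intro k
    simp only [hr]
    refine Continuous.div ((continuous_apply k).max continuous_const)
      (continuous_const.max (continuous_finsetSum _ fun j _ => (continuous_apply j).max continuous_const))
      fun t => (hden t).ne'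
  have hr0 : ∀ t k, 0 ≤ r t k := fun t k => by
    rw [hr]; exact div_nonneg (le_max_right _ _) (hden t).le
  have hr1 : ∀ t, ∑ k, r t k ≤ 1 := fun t => by
    simp only [hr]
    rw [← Finset.sum_div, div_le_one (hden t)]
    exact le_max_right _ _
  have hrle : ∀ t k, r t k ≤ 1 := fun t k =>
    (Finset.single_le_sum (f := fun k => r t k) (fun k _ => hr0 t k) (Finset.mem_univ k)).trans (hr1 t)
  have hrV : ∀ x k, r (V x) k = G x k := by
    intro x k
    have e1 : ∀ j, max (V x j) 0 = G x j := fun j => by rw [hV]; exact max_eq_left (hG0 _ _)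
    rw [hr]
    simp only [e1]
    have : ∑ j : Fin N, G x j ≤ 1 := by rw [← Finset.sum_range (fun j => G x j)]; exact hG1 x
    rw [max_eq_left this, div_one]
  have hrwt : ∀ x, ∑ k ∈ Finset.range N, G x k * frob (a k) (ρ x)
      = ∑ k : Fin N, r (V x) k * frob (a k) (ρ x) := by
    intro x
    rw [Finset.sum_range]
    simp only [hrV]
  have hlim : Tendsto (fun n => ∫ x, ∑ k : Fin N, r (g (ns n) x) k * frob (a k) (ρ x) ∂m) atTop
      (𝓝 (∫ x, ∑ k ∈ Finset.range N, G x k * frob (a k) (ρ x) ∂m)) := by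
    refine tendsto_integral_of_dominated_convergence (fun x => ∑ k : Fin N, |frob (a k) (ρ x)|)
      (fun n => ?_) (integrable_finsetSum _ fun k _ => (hqi k).abs) (fun n => ?_) ?_
    · refine Finset.aestronglyMeasurable_fun_sum _ fun k _ => ?_
      exact ((hrc k).comp (g (ns n)).continuous).aestronglyMeasurable.mul (hqi k).aestronglyMeasurable
    · refine Eventually.of_forall fun x => ?_
      refine (norm_sum_le _ _).trans (Finset.sum_le_sum fun k _ => ?_)
      rw [norm_mul, Real.norm_of_nonneg (hr0 _ _)]
      exact mul_le_of_le_one_left (abs_nonneg _) (hrle _ _)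
    · filter_upwards [hae] with x hx
      rw [hrwt x]
      refine tendsto_finsetSum _ fun k _ => ?_
      exact (((hrc k).tendsto (V x)).comp hx).mul_const _
  refine le_of_tendsto' hlim fun n => ?_
  have hA := hc (fun x => ∑ k : Fin N, r (g (ns n) x) k • a k)
    (continuous_finsetSum _ fun k _ => ((hrc k).comp (g (ns n)).continuous).smul continuous_const)
    (fun x => by
      rw [mem_D_iff]
      intro M hM
      rw [frob_sum_left]
      have h0 : 0 ≤ (f M).toReal := ENNReal.toReal_nonneg
      calc ∑ k : Fin N, r (g (ns n) x) k * frob (a k) M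
          ≤ ∑ k : Fin N, r (g (ns n) x) k * (f M).toReal :=
            Finset.sum_le_sum fun k _ =>
              mul_le_mul_of_nonneg_left ((mem_D_iff f _).1 (ha k) M hM) (hr0 _ _)
        _ = (∑ k : Fin N, r (g (ns n) x) k) * (f M).toReal := by rw [Finset.sum_mul]
        _ ≤ (f M).toReal := mul_le_of_le_one_left h0 (hr1 _))
  simpa only [frob_sum_left] using hA

/-- running maximum -/
def runmax {d : ℕ} (q : ℕ → Ed d → ℝ) : ℕ → Ed d → ℝ
  | 0, _ => 0
  | (n + 1), x => max (runmax q n x) (q n x)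

theorem runmax_meas {d : ℕ} (q : ℕ → Ed d → ℝ) (hq : ∀ n, Measurable (q n)) (N : ℕ) :
    Measurable (runmax q N) := by
  induction N with
  | zero => exact measurable_const
  | succ n ih => exact ih.max (hq n)

theorem runmax_nonneg {d : ℕ} (q : ℕ → Ed d → ℝ) (N : ℕ) (x) : 0 ≤ runmax q N x := by
  induction N with
  | zero => exact le_rfl
  | succ n ih => exact ih.trans (le_max_left _ _)

theorem runmax_rep {d : ℕ} (q : ℕ → Ed d → ℝ) (hq : ∀ n, Measurable (q n)) (N : ℕ) :
    ∃ G : Ed d → ℕ → ℝ, (∀ k, Measurable fun x => G x k) ∧ (∀ x k, 0 ≤ G x k) ∧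
      (∀ x, ∑ k ∈ Finset.range N, G x k ≤ 1) ∧
      ∀ x, ∑ k ∈ Finset.range N, G x k * q k x = runmax q N x := by
  induction N with
  | zero => exact ⟨fun _ _ => 0, fun _ => measurable_const, fun _ _ => le_rfl, by simp, by simp [runmax]⟩
  | succ n ih =>
    obtain ⟨G, h1, h2, h3, h4⟩ := ih
    have hset : MeasurableSet {x | runmax q n x < q n x} :=
      measurableSet_lt (runmax_meas q hq n) (hq n)
    refine ⟨fun x k => if runmax q n x < q n x then (if k = n then 1 else 0)
      else (if k = n then 0 else G x k), ?_, ?_, ?_, ?_⟩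
    · intro k
      refine Measurable.ite hset measurable_const ?_
      by_cases hk : k = n
      · simp only [hk, if_true]; exact measurable_const
      · simp only [hk, if_false]; exact h1 k
    · intro x k
      dsimp only
      split_ifs
      all_goals first | exact zero_le_one | exact le_rfl | exact h2 x k
    · intro x
      by_cases hx : runmax q n x < q n x
      · simp [hx]
      · simp only [hx, if_false]
        rw [Finset.sum_range_succ, if_pos rfl, add_zero]
        refine le_trans (le_of_eq (Finset.sum_congr rfl fun k hk => ?_)) (h3 x)
        rw [if_neg (Finset.mem_range.1 hk).ne]
    · intro x
      by_cases hx : runmax q n x < q n x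
      · simp only [hx, if_true, runmax]
        rw [max_eq_right hx.le]
        simp
      · simp only [hx, if_false, runmax]
        rw [Finset.sum_range_succ, if_pos rfl, zero_mul, add_zero, max_eq_left (not_lt.1 hx), ← h4 x]
        refine Finset.sum_congr rfl fun k hk => ?_
        rw [if_neg (Finset.mem_range.1 hk).ne]

theorem cost_le {d : ℕ} (f : Matd d → ℝ≥0∞) (hA1 : CostA1 f) (hA2 : CostA2 f)
    (m : Measure (Ed d)) [IsFiniteMeasure m]
    (ρ : Ed d → Matd d) (hρm : ∀ i j, Measurable fun x => ρ x i j)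
    (hρi : ∀ i j, Integrable (fun x => ρ x i j) m) (c : ℝ)
    (hc : ∀ A : Ed d → Matd d, Continuous A → (∀ x, A x ∈ domFstar f) →
      ∫ x, frob (A x) (ρ x) ∂m ≤ c) :
    ∫⁻ x, f (ρ x) ∂m ≤ ENNReal.ofReal c ∧ ∀ᵐ x ∂m, f (ρ x) ≠ ⊤ := by
  obtain ⟨a, ha, hf⟩ := bicon_seq f hA1 hA2
  obtain ⟨q, hq⟩ : ∃ q : ℕ → Ed d → ℝ, ∀ n x, q n x = frob (a n) (ρ x) := ⟨_, fun _ _ => rfl⟩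
  have hqm : ∀ n, Measurable (q n) := fun n => by
    have : q n = fun x => frob (a n) (ρ x) := funext (hq n)
    rw [this]
    exact Finset.measurable_sum _ fun i _ => Finset.measurable_sum _ fun j _ => (hρm i j).const_mul _
  have hqi : ∀ n, Integrable (q n) m := fun n => by
    have : q n = fun x => frob (a n) (ρ x) := funext (hq n)
    rw [this]
    exact integrable_finsetSum _ fun i _ => integrable_finsetSum _ fun j _ => (hρi i j).const_mul _
  have hSi : ∀ N, Integrable (runmax q N) m := by
    intro N
    induction N with
    | zero => exact integrable_zero _ _ _
    | succ n ih => exact ih.sup (hqi n)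
  have hSle : ∀ N, ∫ x, runmax q N x ∂m ≤ c := by
    intro N
    obtain ⟨G, h1, h2, h3, h4⟩ := runmax_rep q hqm N
    have := approx_le f m ρ hρi c hc N a ha G h1 h2 h3
    simp only [← hq, h4] at this
    exact this
  have hmono : Monotone fun N x => ENNReal.ofReal (runmax q N x) := by
    refine monotone_nat_of_le_succ fun n x => ENNReal.ofReal_le_ofReal (le_max_left _ _)
  have hSm : ∀ N, Measurable fun x => ENNReal.ofReal (runmax q N x) := fun N =>
    (runmax_meas q hqm N).ennreal_ofReal
  have hsup : ∫⁻ x, ⨆ N, ENNReal.ofReal (runmax q N x) ∂m ≤ ENNReal.ofReal c := by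
    rw [lintegral_iSup hSm hmono]
    refine iSup_le fun N => ?_
    rw [← ofReal_integral_eq_lintegral_ofReal (hSi N)
      (Eventually.of_forall fun x => runmax_nonneg q N x)]
    exact ENNReal.ofReal_le_ofReal (hSle N)
  have hfle : ∀ x, f (ρ x) ≤ ⨆ N, ENNReal.ofReal (runmax q N x) := by
    intro x
    refine (hf (ρ x)).trans (iSup_le fun n => ?_)
    refine le_iSup_of_le (n + 1) (ENNReal.ofReal_le_ofReal ?_)
    rw [← hq]
    exact le_max_right _ _
  refine ⟨(lintegral_mono hfle).trans hsup, ?_⟩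
  have := ae_lt_top (Measurable.iSup hSm) (hsup.trans_lt ENNReal.ofReal_lt_top).ne
  filter_upwards [this] with x hx
  exact ((hfle x).trans_lt hx).ne

theorem Fstat_le {d : ℕ} (f : Matd d → ℝ≥0∞) (hA1 : CostA1 f) (hA2 : CostA2 f)
    (X : Set (Ed d)) (hXc : IsCompact X)
    (μ ν : Measure (Ed d)) [IsFiniteMeasure μ] [IsFiniteMeasure ν] (c : ℝ) (hc : 0 ≤ c)
    (H : ∀ ψ, IsC2c ψ → (∀ x ∈ X, (1/2:ℝ) • hess ψ x ∈ domFstar f) →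
      ∫ x, ψ x ∂ν - ∫ x, ψ x ∂μ ≤ c) : Fstat f X μ ν ≤ ENNReal.ofReal c := by
  obtain ⟨L, hL1, hL2⟩ := HB_D f hA1 X hXc μ ν c hc H
  obtain ⟨m, ρ, hmfin, hmX, hρm, hρi, hrep⟩ := riesz_L f hA1 X hXc L (ker_of_bound f X c hc L hL1)
  obtain ⟨hcost, hfin⟩ := cost_le f hA1 hA2 m ρ hρm hρi c (fun A hA hAD => by
    rw [← hrep A hA ⟨fun x => A x, hA.comp continuous_subtype_val⟩ (fun _ => rfl)]
    exact hL1 _ fun x => hAD x)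
  obtain ⟨ρ', hρ'⟩ : ∃ ρ' : Ed d → Matd d, ∀ x, ρ' x = if (ρ x).PosSemidef then ρ x else 0 :=
    ⟨_, fun _ => rfl⟩
  have hae : ∀ᵐ x ∂m, ρ' x = ρ x := by
    filter_upwards [hfin] with x hx
    rw [hρ', if_pos (hA1.1 _ hx)]
  refine le_trans (sInf_le ⟨m, ρ', ⟨hmfin, hmX, fun x => ?_, fun φ hφ => ?_⟩, rfl⟩) ?_
  · rw [hρ']
    split_ifs with h
    · exact h
    · exact Matrix.PosSemidef.zero
  · have hcont : Continuous fun x => (1/2:ℝ) • hess φ x :=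
      show Continuous ((1/2:ℝ) • hess φ) from (hess_continuous hφ.1).const_smul _
    rw [← hL2 φ hφ ⟨fun x => (1/2:ℝ) • hess φ x, hcont.comp continuous_subtype_val⟩ (fun _ => rfl),
      hrep _ hcont _ (fun _ => rfl)]
    refine integral_congr_ae ?_
    filter_upwards [hae] with x hx
    rw [hx, frob_smul_left]
  · refine le_trans (le_of_eq (lintegral_congr_ae ?_)) hcost
    filter_upwards [hae] with x hx
    rw [hx]

/-- Theorem 4.2. For every `μ, ν ∈ M₊(X)` with `μ(X) = ν(X)`,
`F(μ,ν) = sup { ⟨ν − μ, ψ⟩ : ψ ∈ C²_c(ℝ^d), −ψ = (−ψ)^G on Ω }`. -/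
theorem stmt12 {d : ℕ} (hd : 0 < d) (f : Matd d → ℝ≥0∞) (hA1 : CostA1 f) (hA2 : CostA2 f)
    (Ω X : Set (Ed d)) (hΩopen : IsOpen Ω) (hΩconv : Convex ℝ Ω)
    (hΩbdd : Bornology.IsBounded Ω) (hΩne : Ω.Nonempty) (hX : X = closure Ω)
    (μ ν : Measure (Ed d)) [IsFiniteMeasure μ] [IsFiniteMeasure ν]
    (hμX : μ Xᶜ = 0) (hνX : ν Xᶜ = 0) (hmass : μ X = ν X) :
    Fstat f X μ ν =
      sSup { c : ℝ≥0∞ | ∃ ψ : Ed d → ℝ, IsC2c ψ ∧ GEq f X (fun y => -ψ y) Ω ∧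
        c = ENNReal.ofReal (∫ x, ψ x ∂ν - ∫ x, ψ x ∂μ) } := by
  have hΩX : Ω ⊆ X := hX ▸ subset_closure
  have hXc : IsCompact X := by
    rw [hX]
    exact hΩbdd.isCompact_closure
  refine le_antisymm ?_ ?_
  · by_cases htop : sSup { c : ℝ≥0∞ | ∃ ψ : Ed d → ℝ, IsC2c ψ ∧ GEq f X (fun y => -ψ y) Ω ∧
        c = ENNReal.ofReal (∫ x, ψ x ∂ν - ∫ x, ψ x ∂μ) } = ⊤
    · rw [htop]; exact le_top
    · rw [← ENNReal.ofReal_toReal htop]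
      refine Fstat_le f hA1 hA2 X hXc μ ν _ ENNReal.toReal_nonneg fun ψ hψ hD => ?_
      rw [← ENNReal.ofReal_le_iff_le_toReal htop]
      exact le_sSup ⟨ψ, hψ, GEq_of_D f Ω X hΩX ψ hψ hD, rfl⟩
  · refine sSup_le ?_
    rintro c ⟨ψ, hψ, hG, rfl⟩
    exact weak_dual f X μ ν ψ hψ (D_of_GEq f hA1 Ω X hΩopen hX ψ hψ hG)
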